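/- Let ℓ ≥ 2 and n = 3ℓ+1. A composition c of n is maximal if and only if c = (3^s, 2, 3^t, 2) for some integers s ≥ 1 and t ≥ 0 with s + t = ℓ − 1 (here 3^s denotes s consecutive parts equal to 3). -/

import Mathlib

/-- `i` (1-based, with `1 < i < n`) is a peak of the permutation `σ` of `{1,…,n}`
(represented as a permutation of `Fin n`, position `j` (1-based) being index `j-1`). -/
def IsPeak {n : ℕ} (σ : Equiv.Perm (Fin n)) (i : ℕ) : Prop :=
  ∃ (h₂ : 2 ≤ i) (h₃ : i < n),
    σ ⟨i - 2, by omega⟩ < σ ⟨i - 1, by omega⟩ ∧ σ ⟨i, h₃⟩ < σ ⟨i - 1, by omega⟩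

open Classical in
/-- The peak set of a permutation of `{1,…,n}` (as a set of 1-based positions). -/
noncomputable def peakSet {n : ℕ} (σ : Equiv.Perm (Fin n)) : Finset ℕ :=
  (Finset.range n).filter (fun i => IsPeak σ i)

/-- `P(S;n)`: the number of permutations of `{1,…,n}` with peak set `S`. -/
noncomputable def numPeakSet (n : ℕ) (S : Finset ℕ) : ℕ :=
  Nat.card {σ : Equiv.Perm (Fin n) // peakSet σ = S}

/-- `c` is a composition of `n`: a list of positive integers summing to `n`. -/
def IsComposition (n : ℕ) (c : List ℕ) : Prop :=
  (∀ x ∈ c, 0 < x) ∧ c.sum = n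

/-- The set `S(c)` of proper partial sums of the composition `c`. -/
def compPeaks (c : List ℕ) : Finset ℕ :=
  (Finset.range (c.length - 1)).image (fun i => (c.take (i + 1)).sum)

/-- `P(c)`: the number of permutations of `{1,…,|c|}` whose peak set is `S(c)`. -/
noncomputable def Pcomp (c : List ℕ) : ℕ :=
  numPeakSet c.sum (compPeaks c)

/-- A composition is maximal if `P(b) ≤ P(c)` for every composition `b` of the same size. -/
def IsMaximal (c : List ℕ) : Prop :=
  ∀ b : List ℕ, IsComposition c.sum b → Pcomp b ≤ Pcomp c


/-! ### Analytic part: integral operators -/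
namespace PeakMax

open intervalIntegral
open MeasureTheory (volume)

/-- The Volterra operator. -/
noncomputable def U (f : C(ℝ, ℝ)) : C(ℝ, ℝ) :=
  ⟨fun x => ∫ t in (0:ℝ)..x, f t,
    intervalIntegral.continuous_primitive (fun a b => f.continuous.intervalIntegrable a b) 0⟩

/-- Its adjoint. -/
noncomputable def D (f : C(ℝ, ℝ)) : C(ℝ, ℝ) :=
  ⟨fun x => (∫ t in (0:ℝ)..1, f t) - U f x, by fun_prop⟩

theorem ii (f : C(ℝ, ℝ)) (a b : ℝ) : IntervalIntegrable (fun t => f t) volume a b :=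
  f.continuous.intervalIntegrable a b

theorem U_apply (f : C(ℝ, ℝ)) (x : ℝ) : U f x = ∫ t in (0:ℝ)..x, f t := rfl

theorem D_apply' (f : C(ℝ, ℝ)) (x : ℝ) : D f x = (∫ t in (0:ℝ)..1, f t) - U f x := rfl

theorem D_apply (f : C(ℝ, ℝ)) (x : ℝ) : D f x = ∫ t in x..(1:ℝ), f t := by
  rw [D_apply', U_apply, intervalIntegral.integral_interval_sub_left (ii f _ _) (ii f _ _)]

theorem U_hasDerivAt (f : C(ℝ, ℝ)) (x : ℝ) : HasDerivAt (fun y => U f y) (f x) x :=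
  (f.continuous.integral_hasStrictDerivAt 0 x).hasDerivAt

theorem D_hasDerivAt (f : C(ℝ, ℝ)) (x : ℝ) : HasDerivAt (fun y => D f y) (-f x) x := by
  simpa [D_apply'] using (U_hasDerivAt f x).const_sub (∫ t in (0:ℝ)..1, f t)

theorem U_zero_right (f : C(ℝ, ℝ)) : U f 0 = 0 := by simp [U_apply]
theorem D_one (f : C(ℝ, ℝ)) : D f 1 = 0 := by simp [D_apply]
theorem U_one (f : C(ℝ, ℝ)) : U f 1 = ∫ t in (0:ℝ)..1, f t := rfl
theorem D_zero_right (f : C(ℝ, ℝ)) : D f 0 = ∫ t in (0:ℝ)..1, f t := by simp [D_apply]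

theorem U_unique (f : C(ℝ, ℝ)) (F : ℝ → ℝ) (h : ∀ x, HasDerivAt F (f x) x) (h0 : F 0 = 0)
    (x : ℝ) : U f x = F x := by
  rw [U_apply, integral_eq_sub_of_hasDerivAt (fun y _ => h y) (ii f _ _), h0, sub_zero]

theorem U_add (f g : C(ℝ, ℝ)) : U (f + g) = U f + U g := by
  ext x
  simp only [U_apply, ContinuousMap.add_apply]
  exact integral_add (ii f _ _) (ii g _ _)

theorem D_add (f g : C(ℝ, ℝ)) : D (f + g) = D f + D g := by
  ext x
  simp only [D_apply, ContinuousMap.add_apply]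
  exact integral_add (ii f _ _) (ii g _ _)

theorem U_zero : U 0 = 0 := by ext x; simp [U_apply]
theorem D_zero : D 0 = 0 := by ext x; simp [D_apply]

/-- nonnegativity on the unit interval -/
def Nn (f : C(ℝ, ℝ)) : Prop := ∀ x ∈ Set.Icc (0:ℝ) 1, 0 ≤ f x

theorem U_mono {f g : C(ℝ, ℝ)} (h : ∀ x ∈ Set.Icc (0:ℝ) 1, f x ≤ g x) :
    ∀ x ∈ Set.Icc (0:ℝ) 1, U f x ≤ U g x := by
  intro x hx
  rw [U_apply, U_apply]
  exact integral_mono_on hx.1 (ii f _ _) (ii g _ _)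
    (fun t ht => h t ⟨ht.1, ht.2.trans hx.2⟩)

theorem D_mono {f g : C(ℝ, ℝ)} (h : ∀ x ∈ Set.Icc (0:ℝ) 1, f x ≤ g x) :
    ∀ x ∈ Set.Icc (0:ℝ) 1, D f x ≤ D g x := by
  intro x hx
  rw [D_apply, D_apply]
  exact integral_mono_on hx.2 (ii f _ _) (ii g _ _)
    (fun t ht => h t ⟨hx.1.trans ht.1, ht.2⟩)

theorem Nn.U {f : C(ℝ, ℝ)} (h : Nn f) : Nn (U f) := by
  intro x hx
  have := U_mono (f := 0) (g := f) (fun y hy => by simpa using h y hy) x hx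
  simpa [U_zero] using this

theorem Nn.D {f : C(ℝ, ℝ)} (h : Nn f) : Nn (D f) := by
  intro x hx
  have := D_mono (f := 0) (g := f) (fun y hy => by simpa using h y hy) x hx
  simpa [D_zero] using this

theorem Nn.add {f g : C(ℝ, ℝ)} (hf : Nn f) (hg : Nn g) : Nn (f + g) := by
  intro x hx
  exact add_nonneg (hf x hx) (hg x hx)

theorem Nn.one : Nn 1 := by intro x _; simp
theorem Nn.zero : Nn 0 := by intro x _; simp

theorem Nn.Dit {f : C(ℝ, ℝ)} (h : Nn f) (j : ℕ) : Nn (PeakMax.D^[j] f) := by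
  induction j with
  | zero => exact h
  | succ j ih => rw [Function.iterate_succ_apply']; exact ih.D

/-- inner product on the unit interval -/
noncomputable def ip (f g : C(ℝ, ℝ)) : ℝ := ∫ t in (0:ℝ)..1, f t * g t

theorem ip_comm (f g : C(ℝ, ℝ)) : ip f g = ip g f := by simp [ip, mul_comm]

theorem ip_add (f g k : C(ℝ, ℝ)) : ip f (g + k) = ip f g + ip f k := by
  unfold ip
  rw [← integral_add]
  · simp [mul_add]
  · exact ii (f * g) _ _
  · exact ii (f * k) _ _

theorem add_ip (f g k : C(ℝ, ℝ)) : ip (g + k) f = ip g f + ip k f := by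
  rw [ip_comm, ip_add, ip_comm f g, ip_comm f k]

theorem ip_U (f g : C(ℝ, ℝ)) : ip f (U g) = ip (D f) g := by
  have h := integral_mul_deriv_eq_deriv_mul (a := 0) (b := 1) (u := fun y => D f y)
    (v := fun y => U g y) (u' := fun x => -f x) (v' := fun x => g x)
    (fun x _ => D_hasDerivAt f x) (fun x _ => U_hasDerivAt g x) (ii (-f) _ _) (ii g _ _)
  simp only [D_one, U_zero_right] at h
  unfold ip
  rw [h]
  simp

theorem ip_self_nonneg (f : C(ℝ, ℝ)) : 0 ≤ ip f f :=
  integral_nonneg (by norm_num) (fun t _ => mul_self_nonneg _)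

/-- Cauchy–Schwarz on an interval -/
theorem cs_int (f g : C(ℝ, ℝ)) (a b : ℝ) (hab : a ≤ b) :
    (∫ t in a..b, f t * g t) ^ 2 ≤ (∫ t in a..b, f t ^ 2) * ∫ t in a..b, g t ^ 2 := by
  have h : ∀ x : ℝ, 0 ≤ (∫ t in a..b, g t ^ 2) * (x * x) + (-2 * ∫ t in a..b, f t * g t) * x
      + ∫ t in a..b, f t ^ 2 := by
    intro x
    have h1 : 0 ≤ ∫ t in a..b, (f t - x * g t) ^ 2 :=
      integral_nonneg hab (fun t _ => sq_nonneg _)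
    have h2 : (∫ t in a..b, (f t - x * g t) ^ 2) =
        (∫ t in a..b, g t ^ 2) * (x * x) + (-2 * ∫ t in a..b, f t * g t) * x
      + ∫ t in a..b, f t ^ 2 := by
      have e : (fun t => (f t - x * g t) ^ 2) =
          fun t => (x * x) * (g t ^ 2) + (-2 * x) * (f t * g t) + f t ^ 2 := by
        ext t; ring
      rw [e, integral_add, integral_add, integral_const_mul, integral_const_mul]
      · ring
      all_goals exact Continuous.intervalIntegrable (by fun_prop) _ _
    rw [← h2]; exact h1
  have := discrim_le_zero h
  unfold discrim at this
  nlinarith [this]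

theorem cs (f g : C(ℝ, ℝ)) : ip f g ^ 2 ≤ ip f f * ip g g := by
  have := cs_int f g 0 1 (by norm_num)
  simpa [ip, sq] using this

theorem cs_split (h k1 k2 : C(ℝ, ℝ)) (y : ℝ) (hy : y ∈ Set.Icc (0:ℝ) 1) :
    ((∫ t in (0:ℝ)..y, k1 t * h t) + ∫ t in y..1, k2 t * h t) ^ 2 ≤
      ((∫ t in (0:ℝ)..y, k1 t ^ 2) + ∫ t in y..1, k2 t ^ 2) * ip h h := by
  have e : ip h h = (∫ t in (0:ℝ)..y, h t ^ 2) + ∫ t in y..1, h t ^ 2 := by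
    rw [integral_add_adjacent_intervals]
    · simp [ip, sq]
    all_goals exact Continuous.intervalIntegrable (by fun_prop) _ _
  rw [e]
  have h1 := cs_int k1 h 0 y hy.1
  have h2 := cs_int k2 h y 1 hy.2
  have p1 : 0 ≤ ∫ t in (0:ℝ)..y, k1 t ^ 2 := integral_nonneg hy.1 (fun t _ => sq_nonneg _)
  have p2 : 0 ≤ ∫ t in y..1, k2 t ^ 2 := integral_nonneg hy.2 (fun t _ => sq_nonneg _)
  have p3 : 0 ≤ ∫ t in (0:ℝ)..y, h t ^ 2 := integral_nonneg hy.1 (fun t _ => sq_nonneg _)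
  have p4 : 0 ≤ ∫ t in y..1, h t ^ 2 := integral_nonneg hy.2 (fun t _ => sq_nonneg _)
  generalize (∫ t in (0:ℝ)..y, k1 t * h t) = A at *
  generalize (∫ t in y..1, k2 t * h t) = B at *
  generalize (∫ t in (0:ℝ)..y, k1 t ^ 2) = P at *
  generalize (∫ t in y..1, k2 t ^ 2) = Q at *
  generalize (∫ t in (0:ℝ)..y, h t ^ 2) = H at *
  generalize (∫ t in y..1, h t ^ 2) = K at *
  have key : 2 * (A * B) ≤ P * K + Q * H := by
    have h3 : (A * B) ^ 2 ≤ (P * K) * (Q * H) := by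
      calc (A * B) ^ 2 = A ^ 2 * B ^ 2 := by ring
        _ ≤ (P * H) * (Q * K) := mul_le_mul h1 h2 (sq_nonneg _) (by positivity)
        _ = _ := by ring
    have h4 : (2 * (A * B)) ^ 2 ≤ (P * K + Q * H) ^ 2 := by
      nlinarith [sq_nonneg (P * K - Q * H)]
    exact le_of_sq_le_sq h4 (by positivity)
  nlinarith

/-- `s j f = ∑_{a+b=j} U^b D^a f` -/
noncomputable def s : ℕ → C(ℝ, ℝ) → C(ℝ, ℝ)
  | 0, f => f
  | j + 1, f => U (s j f) + D^[j + 1] f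

/-- the part of `s j f` whose last step is `U` -/
noncomputable def Z : ℕ → C(ℝ, ℝ) → C(ℝ, ℝ)
  | 0, _ => 0
  | j + 1, f => U (s j f)

theorem Z_add (j : ℕ) (f : C(ℝ, ℝ)) : Z j f + D^[j] f = s j f := by
  cases j <;> simp [Z, s]

theorem Nn.s {f : C(ℝ, ℝ)} (h : Nn f) (j : ℕ) : Nn (s j f) := by
  induction j with
  | zero => exact h
  | succ j ih => exact ih.U.add (h.Dit _)

theorem Nn.Z {f : C(ℝ, ℝ)} (h : Nn f) (j : ℕ) : Nn (Z j f) := by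
  cases j with
  | zero => exact Nn.zero
  | succ j => exact (h.s j).U

theorem s_succ' (j : ℕ) (f : C(ℝ, ℝ)) : s (j + 1) f = s j (D f) + U^[j + 1] f := by
  induction j with
  | zero => simp [s, add_comm]
  | succ j ih =>
    rw [s, ih, U_add, s]
    simp only [Function.iterate_succ_apply' U, Function.iterate_succ_apply D]
    abel

theorem ip_Dit (j : ℕ) (f g : C(ℝ, ℝ)) : ip f (D^[j] g) = ip (U^[j] f) g := by
  induction j generalizing f with
  | zero => rfl
  | succ j ih =>
    rw [Function.iterate_succ_apply', ip_comm, ← ip_U, ip_comm, ih, Function.iterate_succ_apply]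

theorem s_symm (j : ℕ) (f g : C(ℝ, ℝ)) : ip g (s j f) = ip (s j g) f := by
  induction j generalizing g with
  | zero => rfl
  | succ j ih => rw [s, ip_add, ip_U, ih, ip_Dit, s_succ', add_ip]

theorem last_eq (j : ℕ) (h : C(ℝ, ℝ)) : ∫ t in (0:ℝ)..1, s j (D h) t = ip h (Z (j + 1) 1) := by
  have : ∫ t in (0:ℝ)..1, s j (D h) t = ip 1 (s j (D h)) := by simp [ip]
  rw [this, s_symm, ip_comm, ← ip_U]
  rfl

/-- crude bound -/
theorem Dit_le {f : C(ℝ, ℝ)} {C : ℝ} (hC : ∀ x ∈ Set.Icc (0:ℝ) 1, f x ≤ C) (j : ℕ) :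
    ∀ x ∈ Set.Icc (0:ℝ) 1, (D^[j] f) x ≤ C * (1 - x) ^ j / j.factorial := by
  induction j with
  | zero => simpa using hC
  | succ j ih =>
    intro x hx
    rw [Function.iterate_succ_apply', D_apply]
    have h1 : ∫ t in x..1, (D^[j] f) t ≤ ∫ t in x..1, C * (1 - t) ^ j / j.factorial :=
      integral_mono_on hx.2 (ii _ _ _) (Continuous.intervalIntegrable (by fun_prop) _ _)
        (fun t ht => ih t ⟨hx.1.trans ht.1, ht.2⟩)
    refine h1.trans (le_of_eq ?_)
    rw [integral_eq_sub_of_hasDerivAt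
      (f := fun t => -(C * (1 - t) ^ (j + 1) / (j + 1).factorial))]
    · simp
    · intro t _
      have h2 : HasDerivAt (fun t : ℝ => 1 - t) (-1) t := (hasDerivAt_id' t).const_sub 1
      refine (((h2.fun_pow (j + 1)).const_mul C).div_const
        ((j + 1).factorial : ℝ)).fun_neg.congr_deriv ?_
      have : (j.factorial : ℝ) ≠ 0 := by positivity
      push_cast [Nat.factorial_succ]
      field_simp
    · exact Continuous.intervalIntegrable (by fun_prop) _ _

theorem U_pow_le {f : C(ℝ, ℝ)} {C : ℝ} (j : ℕ)
    (h : ∀ x ∈ Set.Icc (0:ℝ) 1, f x ≤ C * (1 + x) ^ j / j.factorial) :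
    ∀ x ∈ Set.Icc (0:ℝ) 1, U f x ≤ C * ((1 + x) ^ (j + 1) - 1) / (j + 1).factorial := by
  intro x hx
  rw [U_apply]
  have h1 : ∫ t in 0..x, f t ≤ ∫ t in 0..x, C * (1 + t) ^ j / j.factorial :=
    integral_mono_on hx.1 (ii _ _ _) (Continuous.intervalIntegrable (by fun_prop) _ _)
      (fun t ht => h t ⟨ht.1, ht.2.trans hx.2⟩)
  refine h1.trans (le_of_eq ?_)
  rw [integral_eq_sub_of_hasDerivAt
    (f := fun t => (C * (1 + t) ^ (j + 1) / (j + 1).factorial))]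
  · simp; ring
  · intro t _
    have h2 : HasDerivAt (fun t : ℝ => 1 + t) (1) t := (hasDerivAt_id' t).const_add 1
    refine (((h2.fun_pow (j + 1)).const_mul C).div_const
      ((j + 1).factorial : ℝ)).congr_deriv ?_
    have : (j.factorial : ℝ) ≠ 0 := by positivity
    push_cast [Nat.factorial_succ]
    field_simp
  · exact Continuous.intervalIntegrable (by fun_prop) _ _

theorem s_le {f : C(ℝ, ℝ)} {C : ℝ} (h0 : 0 ≤ C)
    (hC : ∀ x ∈ Set.Icc (0:ℝ) 1, f x ≤ C) (j : ℕ) :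
    ∀ x ∈ Set.Icc (0:ℝ) 1, s j f x ≤ C * (1 + x) ^ j / j.factorial := by
  induction j with
  | zero => simpa [s] using hC
  | succ j ih =>
    intro x hx
    have h1 := U_pow_le j ih x hx
    have h2 := Dit_le hC (j + 1) x hx
    have h3 : C * (1 - x) ^ (j + 1) / (j + 1).factorial ≤ C * 1 / (j + 1).factorial := by
      gcongr
      exact pow_le_one₀ (by linarith [hx.2]) (by linarith [hx.1])
    calc s (j + 1) f x = U (s j f) x + (D^[j + 1] f) x := rfl
      _ ≤ C * ((1 + x) ^ (j + 1) - 1) / (j + 1).factorial + C * 1 / (j + 1).factorial := by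
        linarith
      _ = _ := by ring

theorem bern_le (j : ℕ) (x : ℝ) (hx : x ∈ Set.Icc (0:ℝ) 1) :
    (1 + x) ^ j - 1 ≤ (2 ^ j - 1) * x := by
  induction j with
  | zero => simp
  | succ j ih =>
    have h2 : (1:ℝ) ≤ 2 ^ j := one_le_pow₀ (by norm_num)
    have hx1 := hx.1
    have hx2 := hx.2
    have : (1 + x) ^ j * (1 + x) ≤ ((2 ^ j - 1) * x + 1) * (1 + x) := by
      gcongr; linarith
    rw [pow_succ, pow_succ]
    nlinarith [mul_nonneg (mul_nonneg hx1 (by linarith : (0:ℝ) ≤ 1 - x)) (by linarith : (0:ℝ) ≤ 2 ^ j - 1)]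

theorem norm_le_of_le {f : C(ℝ, ℝ)} (hf : Nn f) (F : ℝ → ℝ) (hF : Continuous F)
    (h : ∀ x ∈ Set.Icc (0:ℝ) 1, f x ≤ F x) : ip f f ≤ ∫ t in (0:ℝ)..1, F t ^ 2 := by
  unfold ip
  refine integral_mono_on (by norm_num) (ii (f * f) _ _)
    (Continuous.intervalIntegrable (by fun_prop) _ _) ?_
  intro x hx
  have := h x hx
  have := hf x hx
  nlinarith

theorem norm_le_of_sq_le {f : C(ℝ, ℝ)} (F : ℝ → ℝ) (hF : Continuous F)
    (h : ∀ x ∈ Set.Icc (0:ℝ) 1, f x ^ 2 ≤ F x) : ip f f ≤ ∫ t in (0:ℝ)..1, F t := by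
  unfold ip
  refine integral_mono_on (by norm_num) (ii (f * f) _ _)
    (Continuous.intervalIntegrable (by fun_prop) _ _) ?_
  intro x hx
  have := h x hx
  nlinarith

theorem Z_norm_crude {f : C(ℝ, ℝ)} (hf : Nn f) {C : ℝ} (h0 : 0 ≤ C)
    (hC : ∀ x ∈ Set.Icc (0:ℝ) 1, f x ≤ C) (j : ℕ) :
    ip (Z (j + 1) f) (Z (j + 1) f) ≤ C ^ 2 * (2 ^ (j + 1) / (j + 1).factorial) ^ 2 / 3 := by
  have h := norm_le_of_le (hf.Z (j + 1)) (fun x => C * (2 ^ (j + 1) / (j + 1).factorial) * x)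
    (by fun_prop) (fun x hx => by
      refine (U_pow_le j (s_le h0 hC j) x hx).trans ?_
      have hb := bern_le (j + 1) x hx
      have : (1 + x) ^ (j + 1) - 1 ≤ 2 ^ (j + 1) * x := by
        have := hx.1
        nlinarith
      calc C * ((1 + x) ^ (j + 1) - 1) / (j + 1).factorial
          ≤ C * (2 ^ (j + 1) * x) / (j + 1).factorial := by gcongr
        _ = _ := by ring)
  refine h.trans (le_of_eq ?_)
  simp only [mul_pow]
  rw [integral_const_mul, integral_pow]
  norm_num
  ring

end PeakMax

namespace PeakMax
open intervalIntegral
open MeasureTheory (volume)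

theorem D_unique (f : C(ℝ, ℝ)) (F : ℝ → ℝ) (h : ∀ x, HasDerivAt F (-f x) x) (h0 : F 1 = 0)
    (x : ℝ) : D f x = F x := by
  have := integral_eq_sub_of_hasDerivAt (a := x) (b := 1) (fun y _ => h y) (ii (-f) _ _)
  rw [h0, integral_neg, ← D_apply] at this
  linarith

/-- multiplication by a power of the variable -/
noncomputable def mom (i : ℕ) (h : C(ℝ, ℝ)) : C(ℝ, ℝ) := ⟨fun t => t ^ i * h t, by fun_prop⟩

theorem mom_apply (i : ℕ) (h : C(ℝ, ℝ)) (t : ℝ) : mom i h t = t ^ i * h t := rfl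

theorem UD_kernel (h : C(ℝ, ℝ)) (y : ℝ) : U (D h) y = U (mom 1 h) y + y * D h y := by
  refine U_unique (D h) (fun y => U (mom 1 h) y + y * D h y) (fun x => ?_)
    (by simp [U_zero_right]) y
  refine ((U_hasDerivAt (mom 1 h) x).fun_add ((hasDerivAt_id' x).fun_mul (D_hasDerivAt h x))).congr_deriv ?_
  simp [mom_apply]

theorem DD_kernel (h : C(ℝ, ℝ)) (y : ℝ) : D (D h) y = D (mom 1 h) y - y * D h y := by
  refine D_unique (D h) (fun y => D (mom 1 h) y - y * D h y) (fun x => ?_)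
    (by simp [D_one]) y
  refine ((D_hasDerivAt (mom 1 h) x).fun_sub ((hasDerivAt_id' x).fun_mul (D_hasDerivAt h x))).congr_deriv ?_
  simp [mom_apply]

theorem DDD_kernel (h : C(ℝ, ℝ)) (y : ℝ) :
    D (D (D h)) y = D (mom 2 h) y / 2 - y * D (mom 1 h) y + y ^ 2 / 2 * D h y := by
  refine D_unique (D (D h))
    (fun y => D (mom 2 h) y / 2 - y * D (mom 1 h) y + y ^ 2 / 2 * D h y) (fun x => ?_)
    (by simp [D_one]) y
  refine ((((D_hasDerivAt (mom 2 h) x).div_const 2).fun_sub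
    ((hasDerivAt_id' x).fun_mul (D_hasDerivAt (mom 1 h) x))).fun_add
    (((hasDerivAt_pow 2 x).div_const 2).fun_mul (D_hasDerivAt h x))).congr_deriv ?_
  rw [DD_kernel]
  simp [mom_apply]
  ring

theorem s1 (f : C(ℝ, ℝ)) (x : ℝ) : s 1 f x = ∫ t in (0:ℝ)..1, f t := by
  simp [s, D_apply']

theorem U_const (f : C(ℝ, ℝ)) (c : ℝ) (h : ∀ x, f x = c) (x : ℝ) : U f x = c * x := by
  simp [U_apply, h, mul_comm]

theorem s2 (f : C(ℝ, ℝ)) (x : ℝ) : s 2 f x = (∫ t in (0:ℝ)..1, f t) * x + D (D f) x := by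
  have := U_const (s 1 f) _ (s1 f) x
  change U (s 1 f) x + D (D f) x = _
  rw [this]

theorem Us2 (f : C(ℝ, ℝ)) (x : ℝ) :
    U (s 2 f) x = (∫ t in (0:ℝ)..1, f t) * x ^ 2 / 2 + U (D (D f)) x := by
  refine U_unique _ (fun x => (∫ t in (0:ℝ)..1, f t) * x ^ 2 / 2 + U (D (D f)) x)
    (fun y => ?_) (by simp [U_zero_right]) x
  refine ((((hasDerivAt_pow 2 y).const_mul _).div_const 2).fun_add (U_hasDerivAt _ y)).congr_deriv ?_
  rw [s2]; simp; ring

theorem s3 (f : C(ℝ, ℝ)) (x : ℝ) :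
    s 3 f x = (∫ t in (0:ℝ)..1, f t) * x ^ 2 / 2 + ∫ t in (0:ℝ)..1, D (D f) t := by
  change U (s 2 f) x + D (D (D f)) x = _
  rw [Us2, D_apply' (D (D f))]; ring

theorem Us3 (f : C(ℝ, ℝ)) (x : ℝ) :
    U (s 3 f) x = (∫ t in (0:ℝ)..1, f t) * x ^ 3 / 6 + (∫ t in (0:ℝ)..1, D (D f) t) * x := by
  refine U_unique _ (fun x => (∫ t in (0:ℝ)..1, f t) * x ^ 3 / 6 + (∫ t in (0:ℝ)..1, D (D f) t) * x)
    (fun y => ?_) (by simp) x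
  refine ((((hasDerivAt_pow 3 y).const_mul _).div_const 6).fun_add
    ((hasDerivAt_id' y).const_mul _)).congr_deriv ?_
  rw [s3]; simp; ring

theorem Us4 (f : C(ℝ, ℝ)) (x : ℝ) :
    U (s 4 f) x = (∫ t in (0:ℝ)..1, f t) * x ^ 4 / 24 + (∫ t in (0:ℝ)..1, D (D f) t) * x ^ 2 / 2
      + U (D (D (D (D f)))) x := by
  refine U_unique _ (fun x => (∫ t in (0:ℝ)..1, f t) * x ^ 4 / 24 +
      (∫ t in (0:ℝ)..1, D (D f) t) * x ^ 2 / 2 + U (D (D (D (D f)))) x)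
    (fun y => ?_) (by simp [U_zero_right]) x
  refine (((((hasDerivAt_pow 4 y).const_mul _).div_const 24).fun_add
    (((hasDerivAt_pow 2 y).const_mul _).div_const 2)).fun_add (U_hasDerivAt _ y)).congr_deriv ?_
  change _ = U (s 3 f) y + D (D (D (D f))) y
  rw [Us3]; simp; ring

theorem U1 (x : ℝ) : U 1 x = x := by simp [U_apply]
theorem UU1 (x : ℝ) : U (U 1) x = x ^ 2 / 2 := by
  refine U_unique _ (fun x => x ^ 2 / 2) (fun y => ?_) (by simp) x
  refine ((hasDerivAt_pow 2 y).div_const 2).congr_deriv ?_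
  rw [U1]; simp
theorem UUU1 (x : ℝ) : U (U (U 1)) x = x ^ 3 / 6 := by
  refine U_unique _ (fun x => x ^ 3 / 6) (fun y => ?_) (by simp) x
  refine ((hasDerivAt_pow 3 y).div_const 6).congr_deriv ?_
  rw [UU1]; simp; ring
theorem UUUU1 (x : ℝ) : U (U (U (U 1))) x = x ^ 4 / 24 := by
  refine U_unique _ (fun x => x ^ 4 / 24) (fun y => ?_) (by simp) x
  refine ((hasDerivAt_pow 4 y).div_const 24).congr_deriv ?_
  rw [UUU1]; simp; ring

theorem int_Dit (j : ℕ) (h : C(ℝ, ℝ)) : ∫ t in (0:ℝ)..1, (D^[j] h) t = ip (U^[j] 1) h := by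
  rw [← ip_Dit]; simp [ip]

theorem c_sq (h : C(ℝ, ℝ)) : (∫ t in (0:ℝ)..1, D h t) ^ 2 ≤ ip h h / 3 := by
  have e := int_Dit 1 h
  simp only [Function.iterate_succ, Function.iterate_zero, Function.comp, id] at e
  rw [e]
  refine (cs _ _).trans (le_of_eq ?_)
  have : ip (U 1) (U 1) = 1 / 3 := by
    simp only [ip, U1, ← sq]; rw [integral_pow]; norm_num
  rw [this]; ring

theorem d_sq (h : C(ℝ, ℝ)) : (∫ t in (0:ℝ)..1, D (D (D h)) t) ^ 2 ≤ ip h h / 252 := by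
  have e := int_Dit 3 h
  simp only [Function.iterate_succ, Function.iterate_zero, Function.comp, id] at e
  rw [e]
  refine (cs _ _).trans (le_of_eq ?_)
  have : ip (U (U (U 1))) (U (U (U 1))) = 1 / 252 := by
    simp only [ip, UUU1]
    have : ∀ x : ℝ, x ^ 3 / 6 * (x ^ 3 / 6) = (1 / 36) * x ^ 6 := by intro x; ring
    simp only [this]; rw [integral_const_mul, integral_pow]; norm_num
  rw [this]; ring

theorem e_sq (h : C(ℝ, ℝ)) : (∫ t in (0:ℝ)..1, D (D (D (D h))) t) ^ 2 ≤ ip h h / 5184 := by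
  have e := int_Dit 4 h
  simp only [Function.iterate_succ, Function.iterate_zero, Function.comp, id] at e
  rw [e]
  refine (cs _ _).trans (le_of_eq ?_)
  have : ip (U (U (U (U 1)))) (U (U (U (U 1)))) = 1 / 5184 := by
    simp only [ip, UUUU1]
    have : ∀ x : ℝ, x ^ 4 / 24 * (x ^ 4 / 24) = (1 / 576) * x ^ 8 := by intro x; ring
    simp only [this]; rw [integral_const_mul, integral_pow]; norm_num
  rw [this]; ring

/-- Gap transfer operator. -/
noncomputable def V (g : ℕ) (h : C(ℝ, ℝ)) : C(ℝ, ℝ) := Z (g - 1) (D h)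

theorem V2_bound (h : C(ℝ, ℝ)) : ip (V 2 h) (V 2 h) ≤ ip h h * (1 / 6) := by
  have key := norm_le_of_sq_le (f := V 2 h) (fun y => (y ^ 3 / 3 + y ^ 2 * (1 - y)) * ip h h)
    (by fun_prop) (fun y hy => by
      have h1 := cs_split h ⟨fun t => t, by fun_prop⟩ ⟨fun _ => y, by fun_prop⟩ y hy
      simp only [ContinuousMap.coe_mk] at h1
      have e : V 2 h y = (∫ t in (0:ℝ)..y, t * h t) + ∫ t in y..1, y * h t := by
        change U (D h) y = _
        rw [UD_kernel, U_apply, D_apply, integral_const_mul]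
        simp [mom_apply]
      rw [e]
      refine h1.trans (le_of_eq ?_)
      rw [integral_pow]
      simp
      left; ring)
  refine key.trans (le_of_eq ?_)
  rw [integral_mul_const]
  have : ∫ y in (0:ℝ)..1, (y ^ 3 / 3 + y ^ 2 * (1 - y)) = 1 / 6 := by
    rw [integral_eq_sub_of_hasDerivAt (f := fun y => y ^ 4 / 12 + y ^ 3 / 3 - y ^ 4 / 4)]
    · norm_num
    · intro y _
      refine ((((hasDerivAt_pow 4 y).div_const 12).fun_add ((hasDerivAt_pow 3 y).div_const 3)).fun_sub
        ((hasDerivAt_pow 4 y).div_const 4)).congr_deriv ?_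
      simp; ring
    · exact Continuous.intervalIntegrable (by fun_prop) _ _
  rw [this]; ring

theorem V4_kernel (h : C(ℝ, ℝ)) (y : ℝ) : V 4 h y =
    y ^ 2 / 2 * U (mom 1 h) y + U (mom 3 h) y / 6 + y / 2 * D (mom 2 h) y + y ^ 3 / 6 * D h y := by
  change U (s 2 (D h)) y = _
  refine U_unique _ (fun y => y ^ 2 / 2 * U (mom 1 h) y + U (mom 3 h) y / 6
    + y / 2 * D (mom 2 h) y + y ^ 3 / 6 * D h y) (fun x => ?_) (by simp [U_zero_right]) y
  refine ((((((hasDerivAt_pow 2 x).div_const 2).fun_mul (U_hasDerivAt (mom 1 h) x)).fun_add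
    ((U_hasDerivAt (mom 3 h) x).div_const 6)).fun_add
    (((hasDerivAt_id' x).div_const 2).fun_mul (D_hasDerivAt (mom 2 h) x))).fun_add
    (((hasDerivAt_pow 3 x).div_const 6).fun_mul (D_hasDerivAt h x))).congr_deriv ?_
  rw [s2, DDD_kernel]
  have e : ∫ t in (0:ℝ)..1, D h t = U (mom 1 h) x + D (mom 1 h) x := by
    rw [← U_one, UD_kernel, D_one, D_apply', U_one]; ring
  rw [e]
  simp [mom_apply]
  ring

theorem V4_bound (h : C(ℝ, ℝ)) : ip (V 4 h) (V 4 h) ≤ ip h h * (302 / 10000) := by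
  have key := norm_le_of_sq_le (f := V 4 h)
    (fun y => (y ^ 7 * (152 / 35) / 36 +
      (9 * y ^ 2 * (1 - y ^ 5) / 5 + 2 * y ^ 4 * (1 - y ^ 3) + y ^ 6 * (1 - y)) / 36) * ip h h)
    (by fun_prop) (fun y hy => by
      have h1 := cs_split h ⟨fun t => y ^ 2 / 2 * t ^ 1 + 1 / 6 * t ^ 3, by fun_prop⟩
        ⟨fun t => y / 2 * t ^ 2 + y ^ 3 / 6, by fun_prop⟩ y hy
      simp only [ContinuousMap.coe_mk] at h1
      have e : V 4 h y = (∫ t in (0:ℝ)..y, (y ^ 2 / 2 * t ^ 1 + 1 / 6 * t ^ 3) * h t) +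
          ∫ t in y..1, (y / 2 * t ^ 2 + y ^ 3 / 6) * h t := by
        rw [V4_kernel, U_apply, U_apply, D_apply, D_apply]
        simp only [add_mul, mul_assoc]
        rw [integral_add, integral_add, integral_const_mul, integral_const_mul, integral_const_mul,
          integral_const_mul]
        · simp [mom_apply]; ring
        all_goals exact Continuous.intervalIntegrable (by fun_prop) _ _
      rw [e]
      refine h1.trans (le_of_eq ?_)
      congr 1
      congr 1
      · rw [integral_eq_sub_of_hasDerivAt
          (f := fun t => y ^ 4 / 12 * t ^ 3 + y ^ 2 / 30 * t ^ 5 + 1 / 252 * t ^ 7)]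
        · ring
        · intro t _
          refine ((((hasDerivAt_pow 3 t).const_mul _).fun_add ((hasDerivAt_pow 5 t).const_mul _)).fun_add
            ((hasDerivAt_pow 7 t).const_mul _)).congr_deriv ?_
          simp; ring
        · exact Continuous.intervalIntegrable (by fun_prop) _ _
      · rw [integral_eq_sub_of_hasDerivAt
          (f := fun t => y ^ 2 / 20 * t ^ 5 + y ^ 4 / 18 * t ^ 3 + y ^ 6 / 36 * t)]
        · ring
        · intro t _
          refine ((((hasDerivAt_pow 5 t).const_mul _).fun_add ((hasDerivAt_pow 3 t).const_mul _)).fun_add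
            ((hasDerivAt_id' t).const_mul _)).congr_deriv ?_
          simp; ring
        · exact Continuous.intervalIntegrable (by fun_prop) _ _)
  refine key.trans ?_
  rw [integral_mul_const]
  have : ∫ y in (0:ℝ)..1, (y ^ 7 * (152 / 35) / 36 +
      (9 * y ^ 2 * (1 - y ^ 5) / 5 + 2 * y ^ 4 * (1 - y ^ 3) + y ^ 6 * (1 - y)) / 36) = 19 / 630 := by
    rw [integral_eq_sub_of_hasDerivAt (f := fun y => y ^ 8 * (152 / 35) / 288 +
      (3 / 5 * y ^ 3 - 9 / 40 * y ^ 8 + 2 / 5 * y ^ 5 - y ^ 8 / 4 + y ^ 7 / 7 - y ^ 8 / 8) / 36)]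
    · norm_num
    · intro y _
      refine HasDerivAt.congr_deriv (f' := 8 * y ^ 7 * (152 / 35) / 288 +
        (3 / 5 * (3 * y ^ 2) - 9 / 40 * (8 * y ^ 7) + 2 / 5 * (5 * y ^ 4) - (8 * y ^ 7) / 4
          + (7 * y ^ 6) / 7 - (8 * y ^ 7) / 8) / 36) ?_ (by ring)
      have p8 : HasDerivAt (fun y : ℝ => y ^ 8) (8 * y ^ 7) y := by simpa using hasDerivAt_pow 8 y
      have p7 : HasDerivAt (fun y : ℝ => y ^ 7) (7 * y ^ 6) y := by simpa using hasDerivAt_pow 7 y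
      have p5 : HasDerivAt (fun y : ℝ => y ^ 5) (5 * y ^ 4) y := by simpa using hasDerivAt_pow 5 y
      have p3 : HasDerivAt (fun y : ℝ => y ^ 3) (3 * y ^ 2) y := by simpa using hasDerivAt_pow 3 y
      exact ((p8.mul_const _).div_const _).fun_add ((((((((p3.const_mul _).fun_sub
        (p8.const_mul _)).fun_add (p5.const_mul _)).fun_sub (p8.div_const _)).fun_add
        (p7.div_const _)).fun_sub (p8.div_const _))).div_const _)
    · exact Continuous.intervalIntegrable (by fun_prop) _ _
  rw [this]
  have := ip_self_nonneg h
  nlinarith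

theorem V3_apply (h : C(ℝ, ℝ)) (y : ℝ) : V 3 h y = (∫ t in (0:ℝ)..1, D h t) * y :=
  U_const (s 1 (D h)) _ (s1 (D h)) y

theorem V3_bound (h : C(ℝ, ℝ)) : ip (V 3 h) (V 3 h) ≤ ip h h / 9 := by
  have key := norm_le_of_sq_le (f := V 3 h) (fun y => ip h h / 3 * y ^ 2)
    (by fun_prop) (fun y hy => by
      rw [V3_apply, mul_pow]
      have := c_sq h
      gcongr)
  refine key.trans (le_of_eq ?_)
  rw [integral_const_mul, integral_pow]; norm_num; ring

theorem V5_bound (h : C(ℝ, ℝ)) : ip (V 5 h) (V 5 h) ≤ ip h h * (6 / 1000) := by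
  have c2 := c_sq h
  have d2 := d_sq h
  have key := norm_le_of_sq_le (f := V 5 h)
    (fun y => (ip h h / 3 * (2 / 36)) * y ^ 6 + (ip h h / 252 * 2) * y ^ 2)
    (by fun_prop) (fun y hy => by
      change (U (s 3 (D h)) y) ^ 2 ≤ _
      rw [Us3]
      generalize (∫ t in (0:ℝ)..1, D h t) = c at *
      generalize (∫ t in (0:ℝ)..1, D (D (D h)) t) = d at *
      have p1 : c ^ 2 * y ^ 6 ≤ ip h h / 3 * y ^ 6 := by gcongr
      have p2 : d ^ 2 * y ^ 2 ≤ ip h h / 252 * y ^ 2 := by gcongr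
      nlinarith [sq_nonneg (c * y ^ 3 / 6 - d * y)])
  refine key.trans ?_
  rw [integral_add, integral_const_mul, integral_const_mul, integral_pow, integral_pow]
  · have := ip_self_nonneg h
    norm_num
    nlinarith
  all_goals exact Continuous.intervalIntegrable (by fun_prop) _ _

theorem V6_bound (h : C(ℝ, ℝ)) (hh : Nn h) : ip (V 6 h) (V 6 h) ≤ ip h h * (1 / 1000) := by
  have c2 := c_sq h
  have d2 := d_sq h
  have e2 := e_sq h
  have hn : Nn (V 6 h) := hh.D.Z 5
  have key := norm_le_of_sq_le (f := V 6 h)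
    (fun y => (ip h h / 3 * (3 / 576)) * y ^ 8 + (ip h h / 252 * (3 / 4)) * y ^ 4
      + (ip h h / 5184 * 3) * y ^ 2)
    (by fun_prop) (fun y hy => by
      have le1 : V 6 h y ≤ (∫ t in (0:ℝ)..1, D h t) * y ^ 4 / 24
          + (∫ t in (0:ℝ)..1, D (D (D h)) t) * y ^ 2 / 2
          + (∫ t in (0:ℝ)..1, D (D (D (D h))) t) * y := by
        change U (s 4 (D h)) y ≤ _
        rw [Us4]
        have := U_mono (f := D (D (D (D (D h)))))
          (g := ContinuousMap.const ℝ (∫ t in (0:ℝ)..1, D (D (D (D h))) t))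
          (fun x hx => by
            have := hh.D.D.D.D.U x hx
            rw [D_apply']; simpa using this) y hy
        rw [U_const (ContinuousMap.const ℝ _) _ (fun _ => rfl)] at this
        linarith
      have le0 := hn y hy
      refine (pow_le_pow_left₀ le0 le1 2).trans ?_
      generalize (∫ t in (0:ℝ)..1, D h t) = c at *
      generalize (∫ t in (0:ℝ)..1, D (D (D h)) t) = d at *
      generalize (∫ t in (0:ℝ)..1, D (D (D (D h))) t) = e at *
      have p1 : c ^ 2 * y ^ 8 ≤ ip h h / 3 * y ^ 8 := by gcongr
      have p2 : d ^ 2 * y ^ 4 ≤ ip h h / 252 * y ^ 4 := by gcongr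
      have p3 : e ^ 2 * y ^ 2 ≤ ip h h / 5184 * y ^ 2 := by gcongr
      nlinarith [sq_nonneg (c * y ^ 4 / 24 - d * y ^ 2 / 2), sq_nonneg (c * y ^ 4 / 24 - e * y),
        sq_nonneg (d * y ^ 2 / 2 - e * y)])
  refine key.trans ?_
  rw [integral_add, integral_add, integral_const_mul, integral_const_mul, integral_const_mul,
    integral_pow, integral_pow, integral_pow]
  · have := ip_self_nonneg h
    norm_num
    nlinarith
  all_goals exact Continuous.intervalIntegrable (by fun_prop) _ _

theorem Vbig_bound (h : C(ℝ, ℝ)) (hh : Nn h) (j : ℕ) : ip (V (j + 2) h) (V (j + 2) h) ≤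
    ip h h * (2 ^ (j + 1) / (j + 1).factorial) ^ 2 / 3 := by
  have h0 := ip_self_nonneg h
  have := Z_norm_crude (f := D h) hh.D (C := Real.sqrt (ip h h)) (Real.sqrt_nonneg _)
    (fun x hx => by
      apply Real.le_sqrt_of_sq_le
      have h1 := cs_split h 0 1 x hx
      simp only [ContinuousMap.zero_apply, ContinuousMap.one_apply, zero_mul, one_mul] at h1
      rw [D_apply]
      simp at h1
      have := hx.1
      nlinarith) j
  rw [Real.sq_sqrt h0] at this
  exact this

/-- First blocks. -/
noncomputable def Fi (c : ℕ) : C(ℝ, ℝ) := Z (c - 1) 1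

theorem Fi2 (y : ℝ) : Fi 2 y = y := U1 y
theorem Fi3 (y : ℝ) : Fi 3 y = y := by
  change U (s 1 1) y = y
  rw [U_const (s 1 1) _ (s1 1)]; simp

theorem D1 (x : ℝ) : D 1 x = 1 - x := by simp [D_apply]
theorem DD1 (x : ℝ) : D (D 1) x = (1 - x) ^ 2 / 2 := by
  refine D_unique _ (fun x => (1 - x) ^ 2 / 2) (fun y => ?_) (by simp) x
  refine (((((hasDerivAt_id' y).const_sub 1).fun_pow 2)).div_const 2).congr_deriv ?_
  rw [D1]; simp; ring

theorem Fi4 (y : ℝ) : Fi 4 y = y / 2 + y ^ 3 / 6 := by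
  change U (s 2 1) y = _
  refine U_unique _ (fun y => y / 2 + y ^ 3 / 6) (fun y => ?_) (by simp) y
  refine (((hasDerivAt_id' y).div_const 2).fun_add ((hasDerivAt_pow 3 y).div_const 6)).congr_deriv ?_
  rw [s2, DD1]; simp; ring

theorem Fi5 (y : ℝ) : Fi 5 y = y / 6 + y ^ 3 / 6 := by
  change U (s 3 1) y = _
  rw [Us3]
  have := int_Dit 2 1
  simp only [Function.iterate_succ, Function.iterate_zero, Function.comp, id] at this
  rw [this]
  have : ip (U (U 1)) 1 = 1 / 6 := by
    simp only [ip, UU1]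
    simp
    norm_num
  rw [this]; simp; ring

theorem ip_poly (f : C(ℝ, ℝ)) (a b : ℝ) (hf : ∀ y, f y = a * y + b * y ^ 3) :
    ip f f = a ^ 2 / 3 + 2 * a * b / 5 + b ^ 2 / 7 := by
  simp only [ip, hf]
  rw [integral_eq_sub_of_hasDerivAt
    (f := fun y => a ^ 2 / 3 * y ^ 3 + 2 * a * b / 5 * y ^ 5 + b ^ 2 / 7 * y ^ 7)]
  · ring
  · intro t _
    refine ((((hasDerivAt_pow 3 t).const_mul _).fun_add ((hasDerivAt_pow 5 t).const_mul _)).fun_add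
      ((hasDerivAt_pow 7 t).const_mul _)).congr_deriv ?_
    simp; ring
  · exact Continuous.intervalIntegrable (by fun_prop) _ _

theorem Fi2_norm : ip (Fi 2) (Fi 2) = 1 / 3 := by
  rw [ip_poly _ 1 0 (fun y => by rw [Fi2]; ring)]; norm_num
theorem Fi3_norm : ip (Fi 3) (Fi 3) = 1 / 3 := by
  rw [ip_poly _ 1 0 (fun y => by rw [Fi3]; ring)]; norm_num
theorem Fi4_norm : ip (Fi 4) (Fi 4) = 38 / 315 := by
  rw [ip_poly _ (1 / 2) (1 / 6) (fun y => by rw [Fi4]; ring)]; norm_num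
theorem Fi5_norm : ip (Fi 5) (Fi 5) ≤ 25 / 1000 := by
  rw [ip_poly _ (1 / 6) (1 / 6) (fun y => by rw [Fi5]; ring)]; norm_num

theorem Fibig (j : ℕ) : ip (Fi (j + 2)) (Fi (j + 2)) ≤
    (2 ^ (j + 1) / (j + 1).factorial) ^ 2 / 3 := by
  have := Z_norm_crude (f := 1) Nn.one (C := 1) (by norm_num) (fun x hx => by simp) j
  rw [one_pow, one_mul] at this
  exact this

end PeakMax

namespace PeakMax
open intervalIntegral
open MeasureTheory (volume)

def wF (c : ℕ) : ℕ := if c = 3 then 0 else if c = 4 then 1 else 2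
def wG (g : ℕ) : ℕ := if g = 3 then 0 else if g = 2 then 1 else 2
def wT : List ℕ → ℕ
  | [] => 0
  | [k] => wF (k + 1)
  | g :: g' :: l => wG g + wT (g' :: l)

theorem r_bounds {r : ℝ} (hr : 0 < r) (h3 : r ^ 3 = 1 / 3) : 693 / 1000 < r ∧ r < 694 / 1000 := by
  constructor
  · by_contra! h
    have : r ^ 3 ≤ (693 / 1000) ^ 3 := by gcongr
    rw [h3] at this; norm_num at this
  · by_contra! h
    have : (694 / 1000 : ℝ) ^ 3 ≤ r ^ 3 := by gcongr
    rw [h3] at this; norm_num at this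

theorem big_le {r : ℝ} (hr : 0 < r) (h3 : r ^ 3 = 1 / 3) (j : ℕ) :
    (2 : ℝ) ^ (j + 5) / (j + 5).factorial ≤ (243 / 100) * r ^ (j + 6) := by
  have hb := r_bounds hr h3
  induction j with
  | zero =>
    have : r ^ 6 = 1 / 9 := by rw [show r ^ 6 = (r ^ 3) ^ 2 by ring, h3]; norm_num
    norm_num [Nat.factorial, this]
  | succ j ih =>
    have e : (2 : ℝ) ^ (j + 1 + 5) / (j + 1 + 5).factorial =
        (2 : ℝ) ^ (j + 5) / (j + 5).factorial * (2 / (j + 6)) := by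
      rw [show j + 1 + 5 = (j + 5) + 1 by ring, Nat.factorial_succ, pow_succ]
      push_cast
      have : ((j + 5).factorial : ℝ) ≠ 0 := by positivity
      field_simp
      ring
    have h2 : (2 : ℝ) / (j + 6) ≤ r := by
      rw [div_le_iff₀ (by positivity)]
      have : (0:ℝ) ≤ j := by positivity
      nlinarith
    rw [e]
    calc _ ≤ (243 / 100) * r ^ (j + 6) * r := by gcongr
      _ = _ := by ring

theorem big_le' {r : ℝ} (hr : 0 < r) (h3 : r ^ 3 = 1 / 3) (j : ℕ) :
    (2 : ℝ) ^ (j + 6) / (j + 6).factorial ≤ (17 / 10) * (81 / 100) * r ^ (j + 7) := by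
  have hb := r_bounds hr h3
  induction j with
  | zero =>
    have : r ^ 7 = 1 / 9 * r := by rw [show r ^ 7 = (r ^ 3) ^ 2 * r by ring, h3]; norm_num
    norm_num [Nat.factorial, this]
    nlinarith
  | succ j ih =>
    have e : (2 : ℝ) ^ (j + 1 + 6) / (j + 1 + 6).factorial =
        (2 : ℝ) ^ (j + 6) / (j + 6).factorial * (2 / (j + 7)) := by
      rw [show j + 1 + 6 = (j + 6) + 1 by ring, Nat.factorial_succ, pow_succ]
      push_cast
      have : ((j + 6).factorial : ℝ) ≠ 0 := by positivity
      field_simp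
      ring
    have h2 : (2 : ℝ) / (j + 7) ≤ r := by
      rw [div_le_iff₀ (by positivity)]
      have : (0:ℝ) ≤ j := by positivity
      nlinarith
    rw [e]
    calc _ ≤ (17 / 10) * (81 / 100) * r ^ (j + 7) * r := by gcongr
      _ = _ := by ring

theorem Fi_bound {r : ℝ} (hr : 0 < r) (h3 : r ^ 3 = 1 / 3) (c : ℕ) (hc : 1 ≤ c) :
    ip (Fi c) (Fi c) ≤ 3 * ((9 / 10) ^ wF c * r ^ c) ^ 2 := by
  have hb := r_bounds hr h3
  have h6 : r ^ 6 = 1 / 9 := by rw [show r ^ 6 = (r ^ 3) ^ 2 by ring, h3]; norm_num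
  obtain rfl | rfl | rfl | rfl | rfl | h : c = 1 ∨ c = 2 ∨ c = 3 ∨ c = 4 ∨ c = 5 ∨ 6 ≤ c := by omega
  · have : ip (Fi 1) (Fi 1) = 0 := by simp [Fi, Z, ip]
    rw [this]; positivity
  · rw [Fi2_norm]
    simp [wF]
    rw [show ((9 / 10 : ℝ) ^ 2 * r ^ 2) ^ 2 = (9 / 10) ^ 4 * (r ^ 3 * r) by ring, h3]
    nlinarith
  · rw [Fi3_norm]
    simp [wF]
    rw [show (r ^ 3) ^ 2 = r ^ 6 by ring, h6]; norm_num
  · rw [Fi4_norm]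
    simp [wF]
    rw [show ((9 / 10 : ℝ) * r ^ 4) ^ 2 = (9 / 10) ^ 2 * (r ^ 6 * r ^ 2) by ring, h6]
    nlinarith
  · refine Fi5_norm.trans ?_
    simp [wF]
    rw [show ((9 / 10 : ℝ) ^ 2 * r ^ 5) ^ 2 = (9 / 10) ^ 4 * (r ^ 6 * r ^ 3 * r) by ring, h6, h3]
    nlinarith
  · obtain ⟨j, rfl⟩ := Nat.exists_eq_add_of_le' h
    have hw : wF (j + 6) = 2 := by simp [wF]
    rw [hw]
    refine (Fibig (j + 4)).trans ?_
    have := big_le hr h3 j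
    have h2 : ((2 : ℝ) ^ (j + 5) / (j + 5).factorial) ^ 2 ≤ ((243 / 100) * r ^ (j + 6)) ^ 2 := by
      gcongr
    change ((2 : ℝ) ^ (j + 5) / (j + 5).factorial) ^ 2 / 3 ≤ _
    calc _ ≤ ((243 / 100) * r ^ (j + 6)) ^ 2 / 3 := by linarith
      _ = _ := by ring

theorem V_bound {r : ℝ} (hr : 0 < r) (h3 : r ^ 3 = 1 / 3) (g : ℕ) (hg : 1 ≤ g)
    (h : C(ℝ, ℝ)) (hh : Nn h) :
    ip (V g h) (V g h) ≤ ip h h * ((9 / 10) ^ wG g * r ^ g) ^ 2 := by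
  have hb := r_bounds hr h3
  have h0 := ip_self_nonneg h
  have h6 : r ^ 6 = 1 / 9 := by rw [show r ^ 6 = (r ^ 3) ^ 2 by ring, h3]; norm_num
  obtain rfl | rfl | rfl | rfl | rfl | rfl | h : g = 1 ∨ g = 2 ∨ g = 3 ∨ g = 4 ∨ g = 5 ∨ g = 6 ∨
    7 ≤ g := by omega
  · have : ip (V 1 h) (V 1 h) = 0 := by simp [V, Z, ip]
    rw [this]; positivity
  · refine (V2_bound h).trans ?_
    gcongr
    simp [wG]
    rw [show ((9 / 10 : ℝ) * r ^ 2) ^ 2 = (9 / 10) ^ 2 * (r ^ 3 * r) by ring, h3]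
    nlinarith
  · refine (V3_bound h).trans (le_of_eq ?_)
    simp [wG]
    rw [show (r ^ 3) ^ 2 = r ^ 6 by ring, h6]; ring
  · refine (V4_bound h).trans ?_
    gcongr
    simp [wG]
    rw [show ((9 / 10 : ℝ) ^ 2 * r ^ 4) ^ 2 = (9 / 10) ^ 4 * (r ^ 6 * r ^ 2) by ring, h6]
    nlinarith
  · refine (V5_bound h).trans ?_
    gcongr
    simp [wG]
    rw [show ((9 / 10 : ℝ) ^ 2 * r ^ 5) ^ 2 = (9 / 10) ^ 4 * (r ^ 6 * r ^ 3 * r) by ring, h6, h3]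
    nlinarith
  · refine (V6_bound h hh).trans ?_
    gcongr
    simp [wG]
    rw [h6]; norm_num
  · obtain ⟨j, rfl⟩ := Nat.exists_eq_add_of_le' h
    have hw : wG (j + 7) = 2 := by simp [wG]
    rw [hw]
    refine (Vbig_bound _ hh (j + 5)).trans ?_
    have := big_le' hr h3 j
    have h2 : ((2 : ℝ) ^ (j + 6) / (j + 6).factorial) ^ 2 ≤
      ((17 / 10) * (81 / 100) * r ^ (j + 7)) ^ 2 := by
      gcongr
    rw [mul_div_assoc]
    gcongr
    change ((2 : ℝ) ^ (j + 6) / (j + 6).factorial) ^ 2 / 3 ≤ _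
    have : 0 ≤ (r ^ (j + 7)) ^ 2 := sq_nonneg _
    nlinarith

/-- The normalised count attached to a list of parts, started from the density `f`. -/
noncomputable def run : List ℕ → C(ℝ, ℝ) → ℝ
  | [], _ => 0
  | [c], f => ∫ t in (0:ℝ)..1, s (c - 1) f t
  | c :: c' :: l, f => run (c' :: l) (D (Z (c - 1) f))

theorem run_last (k : ℕ) (hk : 1 ≤ k) (h : C(ℝ, ℝ)) : run [k] (D h) = ip h (Fi (k + 1)) := by
  obtain ⟨j, rfl⟩ := Nat.exists_eq_add_of_le' hk
  exact last_eq j h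

theorem run_cons (g g' : ℕ) (l : List ℕ) (h : C(ℝ, ℝ)) :
    run (g :: g' :: l) (D h) = run (g' :: l) (D (V g h)) := rfl

theorem run_cons_ne (g : ℕ) (l : List ℕ) (hl : l ≠ []) (h : C(ℝ, ℝ)) :
    run (g :: l) (D h) = run l (D (V g h)) := by
  cases l with
  | nil => exact absurd rfl hl
  | cons g' l => exact run_cons g g' l h

theorem run_one_ne (c : ℕ) (l : List ℕ) (hl : l ≠ []) :
    run (c :: l) 1 = run l (D (Fi c)) := by
  cases l with
  | nil => exact absurd rfl hl
  | cons g' l => rfl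

theorem V2_eq (h : C(ℝ, ℝ)) : V 2 h = U (D h) := rfl

theorem int_D (h : C(ℝ, ℝ)) : ∫ t in (0:ℝ)..1, D h t = ip h (Fi 2) := last_eq 0 h

theorem run_nonneg (l : List ℕ) (f : C(ℝ, ℝ)) (hf : Nn f) : 0 ≤ run l f := by
  induction l generalizing f with
  | nil => exact le_refl _
  | cons g l ih =>
    cases l with
    | nil => exact integral_nonneg (by norm_num) (fun t ht => hf.s _ t ht)
    | cons g' l => exact ih _ (hf.Z _).D

theorem run_bound {r : ℝ} (hr : 0 < r) (h3 : r ^ 3 = 1 / 3) (g : ℕ) (l : List ℕ)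
    (hl : ∀ x ∈ g :: l, 0 < x) (h : C(ℝ, ℝ)) (hh : Nn h) :
    run (g :: l) (D h) ^ 2 ≤
      ip h h * (3 * ((9 / 10) ^ wT (g :: l) * r ^ ((g :: l).sum + 1)) ^ 2) := by
  induction l generalizing g h with
  | nil =>
    have hg : 1 ≤ g := hl g (by simp)
    rw [run_last g hg]
    refine (cs _ _).trans ?_
    have := ip_self_nonneg h
    gcongr
    have := Fi_bound hr h3 (g + 1) (by omega)
    simpa [wT] using this
  | cons g' l ih =>
    have hg : 1 ≤ g := hl g (by simp)
    rw [run_cons]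
    refine (ih g' (fun x hx => hl x (by simp at hx ⊢; tauto)) (V g h) (hh.D.Z _)).trans ?_
    have := V_bound hr h3 g hg h hh
    have e : wT (g :: g' :: l) = wG g + wT (g' :: l) := rfl
    rw [e]
    calc _ ≤ (ip h h * ((9 / 10) ^ wG g * r ^ g) ^ 2) *
          (3 * ((9 / 10) ^ wT (g' :: l) * r ^ ((g' :: l).sum + 1)) ^ 2) := by gcongr
      _ = _ := by simp only [List.sum_cons]; ring

theorem run_total {r : ℝ} (hr : 0 < r) (h3 : r ^ 3 = 1 / 3) (c g : ℕ) (l : List ℕ)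
    (hl : ∀ x ∈ c :: g :: l, 0 < x) :
    run (c :: g :: l) 1 ≤
      3 * ((9 / 10) ^ (wF c + wT (g :: l)) * r ^ ((c :: g :: l).sum + 1)) := by
  have hc : 1 ≤ c := hl c (by simp)
  have h1 := run_bound hr h3 g l (fun x hx => hl x (by simp at hx ⊢; tauto)) (Fi c) (Nn.one.Z _)
  have h2 := Fi_bound hr h3 c hc
  have e : run (c :: g :: l) 1 = run (g :: l) (D (Fi c)) := rfl
  rw [e]
  refine le_of_sq_le_sq ?_ (by positivity)
  refine h1.trans ?_
  calc _ ≤ (3 * ((9 / 10) ^ wF c * r ^ c) ^ 2) *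
      (3 * ((9 / 10) ^ wT (g :: l) * r ^ ((g :: l).sum + 1)) ^ 2) := by gcongr
    _ = _ := by simp only [List.sum_cons]; ring

theorem wT_zero (g : ℕ) (l : List ℕ) (h : wT (g :: l) = 0) :
    ∃ t, g :: l = List.replicate t 3 ++ [2] := by
  induction l generalizing g with
  | nil =>
    refine ⟨0, ?_⟩
    simp only [wT, wF] at h
    split_ifs at h
    simp; omega
  | cons g' l ih =>
    have e : wT (g :: g' :: l) = wG g + wT (g' :: l) := rfl
    obtain ⟨t, ht⟩ := ih g' (by omega)
    have hg : g = 3 := by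
      have : wG g = 0 := by omega
      simp only [wG] at this
      split_ifs at this
      assumption
    exact ⟨t + 1, by rw [ht, hg]; simp [List.replicate_succ]⟩

theorem wT_one (g : ℕ) (l : List ℕ) (h : wT (g :: l) = 1) :
    (∃ s t, g :: l = List.replicate s 3 ++ [2] ++ List.replicate t 3 ++ [2]) ∨
      ∃ t, g :: l = List.replicate t 3 ++ [3] := by
  induction l generalizing g with
  | nil =>
    right
    refine ⟨0, ?_⟩
    simp only [wT, wF] at h
    have : g = 3 := by split_ifs at h <;> omega
    simp [this]
  | cons g' l ih =>
    have e : wT (g :: g' :: l) = wG g + wT (g' :: l) := rfl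
    by_cases hg : g = 3
    · have hw : wG g = 0 := by simp [wG, hg]
      rcases ih g' (by omega) with ⟨s, t, ht⟩ | ⟨t, ht⟩
      · left
        exact ⟨s + 1, t, by rw [ht, hg]; simp [List.replicate_succ]⟩
      · right
        exact ⟨t + 1, by rw [ht, hg]; simp [List.replicate_succ]⟩
    · have hg2 : g = 2 ∧ wG g = 1 := by
        have : wG g ≤ 1 := by omega
        simp only [wG] at this ⊢
        split_ifs at this ⊢ <;> simp_all
      obtain ⟨t, ht⟩ := wT_zero g' l (by omega)
      left
      exact ⟨0, t, by rw [ht, hg2.1]; simp⟩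

/-- Exact value for the extremal compositions. -/
theorem V3_Fi3 : V 3 (Fi 3) = (1 / 3 : ℝ) • Fi 3 := by
  ext y
  rw [V3_apply]
  have e := int_Dit 1 (Fi 3)
  simp only [Function.iterate_succ, Function.iterate_zero, Function.comp, id] at e
  have : ip (U 1) (Fi 3) = 1 / 3 := by
    simp only [ip, U1, Fi3, ← sq]; rw [integral_pow]; norm_num
  rw [e, this]; simp [Fi3]

theorem U_smul (a : ℝ) (f : C(ℝ, ℝ)) : U (a • f) = a • U f := by
  ext x; simp [U_apply]
theorem D_smul (a : ℝ) (f : C(ℝ, ℝ)) : D (a • f) = a • D f := by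
  ext x; simp [D_apply]
theorem Dit_smul (a : ℝ) (f : C(ℝ, ℝ)) (j : ℕ) : D^[j] (a • f) = a • D^[j] f := by
  induction j with
  | zero => rfl
  | succ j ih => rw [Function.iterate_succ_apply', ih, D_smul, Function.iterate_succ_apply']
theorem s_smul (a : ℝ) (f : C(ℝ, ℝ)) (j : ℕ) : s j (a • f) = a • s j f := by
  induction j with
  | zero => rfl
  | succ j ih => simp only [s]; rw [ih, U_smul, Dit_smul, smul_add]
theorem Z_smul (a : ℝ) (f : C(ℝ, ℝ)) (j : ℕ) : Z j (a • f) = a • Z j f := by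
  cases j with
  | zero => simp [Z]
  | succ j => simp only [Z]; rw [s_smul, U_smul]

theorem run_smul (l : List ℕ) (a : ℝ) (f : C(ℝ, ℝ)) : run l (a • f) = a * run l f := by
  induction l generalizing f with
  | nil => simp [run]
  | cons g l ih =>
    cases l with
    | nil => simp only [run]; rw [s_smul]; simp
    | cons g' l => simp only [run]; rw [Z_smul, D_smul, ih]

theorem V3_any (h : C(ℝ, ℝ)) : V 3 h = (∫ t in (0:ℝ)..1, D h t) • Fi 3 := by
  ext y; rw [V3_apply]; simp [Fi3]

theorem run_rep (t : ℕ) : run (List.replicate t 3 ++ [2]) (D (Fi 3)) = (1 / 3) * (1 / 3) ^ t := by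
  induction t with
  | zero =>
    simp only [List.replicate_zero, List.nil_append, pow_zero, mul_one]
    rw [run_last 2 (by norm_num), Fi3_norm]
  | succ t ih =>
    have : List.replicate (t + 1) 3 ++ [2] = 3 :: (List.replicate t 3 ++ [2]) := by
      simp [List.replicate_succ]
    rw [this]
    have h2 : run (3 :: (List.replicate t 3 ++ [2])) (D (Fi 3)) =
        run (List.replicate t 3 ++ [2]) (D (V 3 (Fi 3))) := run_cons_ne _ _ (by simp) _
    rw [h2, V3_Fi3, D_smul, run_smul, ih]; ring

theorem run_rep2 (t : ℕ) :
    run (2 :: (List.replicate t 3 ++ [2])) (D (Fi 3)) = (2 / 15) * (1 / 3) ^ t := by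
  have h2 : run (2 :: (List.replicate t 3 ++ [2])) (D (Fi 3)) =
      run (List.replicate t 3 ++ [2]) (D (V 2 (Fi 3))) := run_cons_ne _ _ (by simp) _
  have e1 : ip (V 2 (Fi 3)) (Fi 3) = 2 / 15 := by
    have : ∀ y, D (Fi 3) y = (1 - y ^ 2) / 2 := by
      intro y
      rw [D_apply]; simp [Fi3]
    have e : ip (V 2 (Fi 3)) (Fi 3) = ip (D (Fi 3)) (D (Fi 3)) := by
      rw [ip_comm, V2_eq, ip_U]
    rw [e]
    simp only [ip, this]
    rw [integral_eq_sub_of_hasDerivAt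
      (f := fun y : ℝ => 1 / 4 * y - 1 / 6 * y ^ 3 + 1 / 20 * y ^ 5)]
    · norm_num
    · intro t _
      refine ((((hasDerivAt_id' t).const_mul _).fun_sub ((hasDerivAt_pow 3 t).const_mul _)).fun_add
        ((hasDerivAt_pow 5 t).const_mul _)).congr_deriv ?_
      simp; ring
    · exact Continuous.intervalIntegrable (by fun_prop) _ _
  rw [h2]
  cases t with
  | zero =>
    simp only [List.replicate_zero, List.nil_append, pow_zero, mul_one]
    rw [run_last 2 (by norm_num), e1]
  | succ t =>
    have : List.replicate (t + 1) 3 ++ [2] = 3 :: (List.replicate t 3 ++ [2]) := by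
      simp [List.replicate_succ]
    rw [this]
    have h2 : run (3 :: (List.replicate t 3 ++ [2])) (D (V 2 (Fi 3))) =
        run (List.replicate t 3 ++ [2]) (D (V 3 (V 2 (Fi 3)))) := run_cons_ne _ _ (by simp) _
    have e3 : ∫ t in (0:ℝ)..1, D (V 2 (Fi 3)) t = 2 / 15 := by
      have e4 : Fi 2 = Fi 3 := by ext y; rw [Fi2, Fi3]
      rw [int_D, e4, e1]
    rw [h2, V3_any, D_smul, run_smul, run_rep, e3]; ring

theorem run_extremal (a t : ℕ) :
    run (List.replicate (a + 1) 3 ++ [2] ++ List.replicate t 3 ++ [2]) 1 =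
      (2 / 15) * (1 / 3) ^ (a + t) := by
  have h1 : ∀ a, run (List.replicate a 3 ++ (2 :: (List.replicate t 3 ++ [2]))) (D (Fi 3)) =
      (2 / 15) * (1 / 3) ^ (a + t) := by
    intro a
    induction a with
    | zero => simp [run_rep2]
    | succ a ih =>
      have h2 : run (List.replicate (a + 1) 3 ++ (2 :: (List.replicate t 3 ++ [2]))) (D (Fi 3)) =
        run (List.replicate a 3 ++ (2 :: (List.replicate t 3 ++ [2]))) (D (V 3 (Fi 3))) := by
        rw [List.replicate_succ, List.cons_append]
        exact run_cons_ne _ _ (by simp) _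
      rw [h2, V3_Fi3, D_smul, run_smul, ih]; ring
  have h3 : run (List.replicate (a + 1) 3 ++ (2 :: (List.replicate t 3 ++ [2]))) 1 =
    run (List.replicate a 3 ++ (2 :: (List.replicate t 3 ++ [2]))) (D (Fi 3)) := by
    rw [List.replicate_succ, List.cons_append]
    exact run_one_ne _ _ (by simp)
  rw [← h1, ← h3]
  simp

theorem run_single (m : ℕ) :
    run [3 * (m + 2) + 1] 1 < (2 / 15) * (1 / 3) ^ m := by
  have h0 : run [3 * (m + 2) + 1] 1 ≤ 2 ^ (3 * (m + 2)) / (3 * (m + 2)).factorial := by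
    have h := s_le (f := 1) (C := 1) (by norm_num) (fun x _ => by simp) (3 * (m + 2))
    change ∫ t in (0:ℝ)..1, s (3 * (m + 2)) 1 t ≤ _
    have := integral_mono_on (a := 0) (b := 1) (f := fun t => s (3 * (m + 2)) 1 t)
      (g := fun _ => (2:ℝ) ^ (3 * (m + 2)) / (3 * (m + 2)).factorial) (μ := volume) (by norm_num)
      (ii _ _ _) (Continuous.intervalIntegrable (by fun_prop) _ _) (fun x hx => by
        refine (h x hx).trans ?_
        rw [one_mul]
        have := hx.1
        gcongr
        linarith [hx.2])
    simpa using this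
  refine h0.trans_lt ?_
  clear h0
  induction m with
  | zero => norm_num [Nat.factorial]
  | succ m ih =>
    have e : (2:ℝ) ^ (3 * (m + 1 + 2)) / (3 * (m + 1 + 2)).factorial =
      2 ^ (3 * (m + 2)) / (3 * (m + 2)).factorial *
        (8 / ((3 * m + 7) * (3 * m + 8) * (3 * m + 9))) := by
      rw [show 3 * (m + 1 + 2) = (3 * (m + 2)) + 1 + 1 + 1 by ring, Nat.factorial_succ,
        Nat.factorial_succ, Nat.factorial_succ, pow_succ, pow_succ, pow_succ]
      push_cast
      have : ((3 * (m + 2)).factorial : ℝ) ≠ 0 := by positivity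
      field_simp
      ring
    have h2 : (8:ℝ) / ((3 * m + 7) * (3 * m + 8) * (3 * m + 9)) ≤ 1 / 3 := by
      rw [div_le_div_iff₀ (by positivity) (by norm_num)]
      have : (0:ℝ) ≤ m := by positivity
      nlinarith [mul_nonneg this this, mul_nonneg this (mul_nonneg this this)]
    rw [e]
    calc _ ≤ 2 ^ (3 * (m + 2)) / ((3 * (m + 2)).factorial : ℝ) * (1 / 3) := by gcongr
      _ < (2 / 15) * (1 / 3) ^ m * (1 / 3) := by gcongr
      _ = _ := by ring

/-- Main analytic dichotomy. -/
theorem run_dichotomy (m : ℕ) (c : List ℕ) (hpos : ∀ x ∈ c, 0 < x)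
    (hsum : c.sum = 3 * (m + 2) + 1) :
    (∃ a t : ℕ, a + t = m ∧
      c = List.replicate (a + 1) 3 ++ [2] ++ List.replicate t 3 ++ [2]) ∨
      run c 1 < (2 / 15) * (1 / 3) ^ m := by
  obtain ⟨r, hr, h3⟩ : ∃ r : ℝ, 0 < r ∧ r ^ 3 = 1 / 3 := by
    refine ⟨(1 / 3 : ℝ) ^ (1 / 3 : ℝ), by positivity, ?_⟩
    rw [← Real.rpow_natCast, ← Real.rpow_mul (by norm_num)]
    norm_num
  have hb := r_bounds hr h3
  match c, hpos, hsum with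
  | [], _, h => simp at h
  | [k], _, h =>
    right
    simp at h
    rw [h]
    exact run_single m
  | c :: g :: l, hpos, hsum =>
    by_cases hw : 2 ≤ wF c + wT (g :: l)
    · right
      refine (run_total hr h3 c g l hpos).trans_lt ?_
      have h1 : (9 / 10 : ℝ) ^ (wF c + wT (g :: l)) ≤ (9 / 10) ^ 2 :=
        pow_le_pow_of_le_one (by norm_num) (by norm_num) hw
      rw [hsum]
      have h2 : r ^ (3 * (m + 2) + 1 + 1) = (1 / 3) ^ m * (1 / 9) * r ^ 2 := by
        rw [show r ^ (3 * (m + 2) + 1 + 1) = (r ^ 3) ^ m * (r ^ 3) ^ 2 * r ^ 2 by ring, h3]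
        ring
      rw [h2]
      have h4 : (0:ℝ) < (1 / 3) ^ m := by positivity
      have h5 : 0 ≤ (1 / 3 : ℝ) ^ m * (1 / 9) * r ^ 2 := by positivity
      calc _ ≤ 3 * ((9 / 10 : ℝ) ^ 2 * ((1 / 3) ^ m * (1 / 9) * r ^ 2)) := by gcongr
        _ = (27 / 100 * r ^ 2) * (1 / 3) ^ m := by ring
        _ < _ := by
          gcongr
          nlinarith
    · left
      have hsum' : c + (g :: l).sum = 3 * (m + 2) + 1 := by simpa using hsum
      have hcF : (c = 3 ∧ wF c = 0) ∨ (c = 4 ∧ wF c = 1) := by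
        have : wF c ≤ 1 := by omega
        simp only [wF] at this ⊢
        split_ifs at this ⊢ <;> simp_all
      rcases hcF with ⟨hc, hwc⟩ | ⟨hc, hwc⟩
      · obtain h0 | h1 : wT (g :: l) = 0 ∨ wT (g :: l) = 1 := by omega
        · obtain ⟨t, ht⟩ := wT_zero g l h0
          rw [ht] at hsum'
          simp at hsum'
          omega
        · rcases wT_one g l h1 with ⟨a, t, ht⟩ | ⟨t, ht⟩
          · refine ⟨a, t, ?_, ?_⟩
            · rw [ht] at hsum'
              simp at hsum'
              omega
            · rw [ht, hc]; simp [List.replicate_succ]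
          · rw [ht] at hsum'
            simp at hsum'
            omega
      · obtain ⟨t, ht⟩ := wT_zero g l (by omega)
        rw [ht] at hsum'
        simp at hsum'
        omega

end PeakMax

namespace PeakMax
open intervalIntegral
open MeasureTheory (volume)

/-! ### Bernstein-type densities -/

/-- The density of the last value, up to normalisation. -/
noncomputable def bb (a c : ℕ) : C(ℝ, ℝ) :=
  ⟨fun x => x ^ a * (1 - x) ^ c / (a.factorial * c.factorial), by fun_prop⟩

theorem bb_apply (a c : ℕ) (x : ℝ) :
    bb a c x = x ^ a * (1 - x) ^ c / (a.factorial * c.factorial) := rfl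

theorem bb_deriv (a c : ℕ) (x : ℝ) :
    HasDerivAt (fun y => bb (a + 1) (c + 1) y) (bb a (c + 1) x - bb (a + 1) c x) x := by
  have h := (((hasDerivAt_pow (a + 1) x).fun_mul
    (((hasDerivAt_id' x).const_sub 1).fun_pow (c + 1))).div_const
      ((a + 1).factorial * (c + 1).factorial : ℝ))
  refine h.congr_deriv ?_
  simp only [bb_apply, Nat.factorial_succ]
  push_cast
  have h1 : (a.factorial : ℝ) ≠ 0 := by positivity
  have h2 : (c.factorial : ℝ) ≠ 0 := by positivity
  field_simp
  ring

theorem U_bb_succ (a c : ℕ) : U (bb a (c + 1)) = bb (a + 1) (c + 1) + U (bb (a + 1) c) := by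
  ext x
  refine U_unique _ (fun y => bb (a + 1) (c + 1) y + U (bb (a + 1) c) y) (fun y => ?_) ?_ x
  · exact ((bb_deriv a c y).fun_add (U_hasDerivAt _ y)).congr_deriv (by ring)
  · simp [bb_apply, U_zero_right]

theorem U_bb_zero (a : ℕ) : U (bb a 0) = bb (a + 1) 0 := by
  ext x
  refine U_unique _ (fun y => bb (a + 1) 0 y) (fun y => ?_) ?_ x
  · have h := (hasDerivAt_pow (a + 1) y).div_const ((a + 1).factorial : ℝ)
    have e : (fun y => bb (a + 1) 0 y) = fun y => y ^ (a + 1) / ((a + 1).factorial : ℝ) := by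
      funext y; simp [bb_apply]
    rw [e]
    refine h.congr_deriv ?_
    simp only [bb_apply, Nat.factorial_succ]
    push_cast
    have h1 : (a.factorial : ℝ) ≠ 0 := by positivity
    field_simp
    simp
  · simp [bb_apply]

theorem U_bb (a c : ℕ) : U (bb a c) = ∑ j ∈ Finset.range (c + 1), bb (a + 1 + j) (c - j) := by
  induction c generalizing a with
  | zero => simp [U_bb_zero]
  | succ c ih =>
    rw [U_bb_succ, ih, Finset.sum_range_succ' _ (c + 1), add_comm]
    congr 1
    refine Finset.sum_congr rfl (fun j _ => ?_)
    congr 1 <;> omega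

theorem int_bb (a c : ℕ) : ∫ t in (0:ℝ)..1, bb a c t = 1 / ((a + c + 1).factorial : ℝ) := by
  rw [← U_one, U_bb, ContinuousMap.sum_apply, Finset.sum_range_succ, Finset.sum_eq_zero]
  · simp [bb_apply, show a + 1 + c = a + c + 1 by ring]
  · intro j hj
    have : c - j ≠ 0 := by have := Finset.mem_range.1 hj; omega
    simp [bb_apply, this]

/-- Density of the last value being the `k`-th smallest among `n + 1`. -/
noncomputable def BB (n k : ℕ) : C(ℝ, ℝ) := bb k (n - k)

theorem BB_sum (n : ℕ) (x : ℝ) : ∑ k ∈ Finset.range (n + 1), BB n k x = 1 / (n.factorial : ℝ) := by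
  have h := add_pow x (1 - x) n
  rw [add_sub_cancel, one_pow] at h
  rw [h, Finset.sum_div]
  refine Finset.sum_congr rfl (fun k hk => ?_)
  have hk' : k ≤ n := by have := Finset.mem_range.1 hk; omega
  have h2 := Nat.choose_mul_factorial_mul_factorial hk'
  have h3 : (n.choose k : ℝ) * k.factorial * (n - k).factorial = n.factorial := by exact_mod_cast h2
  rw [BB, bb_apply, ← h3]
  have h4 : (n.choose k : ℝ) ≠ 0 := by
    have := Nat.choose_pos hk'
    positivity
  field_simp

theorem U_BB (n j : ℕ) (hj : j ≤ n) :
    U (BB n j) = ∑ k ∈ Finset.range (n + 2), if j < k then BB (n + 1) k else 0 := by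
  rw [← Finset.sum_filter]
  have : (Finset.range (n + 2)).filter (fun k => j < k) = Finset.Ico (j + 1) (n + 2) := by
    ext k; simp; omega
  rw [this, Finset.sum_Ico_eq_sum_range, BB, U_bb, show n - j + 1 = n + 2 - (j + 1) by omega]
  refine Finset.sum_congr rfl (fun k hk => ?_)
  rw [BB]; congr 1; omega

theorem D_BB (n j : ℕ) (hj : j ≤ n) :
    D (BB n j) = ∑ k ∈ Finset.range (n + 2), if k ≤ j then BB (n + 1) k else 0 := by
  ext x
  rw [D_apply', U_BB n j hj, BB, int_bb, show j + (n - j) + 1 = n + 1 by omega,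
    ← BB_sum (n + 1) x, ContinuousMap.sum_apply, ContinuousMap.sum_apply, ← Finset.sum_sub_distrib]
  refine Finset.sum_congr rfl (fun k hk => ?_)
  by_cases h : k ≤ j
  · simp [h, not_lt.2 h]
  · simp [h, not_le.1 h]

theorem U_sum {ι : Type*} (t : Finset ι) (f : ι → C(ℝ, ℝ)) : U (∑ i ∈ t, f i) = ∑ i ∈ t, U (f i) :=
  map_sum (AddMonoidHom.mk' U U_add) f t

theorem D_sum {ι : Type*} (t : Finset ι) (f : ι → C(ℝ, ℝ)) : D (∑ i ∈ t, f i) = ∑ i ∈ t, D (f i) :=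
  map_sum (AddMonoidHom.mk' D D_add) f t

/-! ### Inserting a last value into a permutation -/

/-- Append a last value `k` to the permutation `τ`. -/
def ins {n : ℕ} (k : Fin (n + 2)) (τ : Equiv.Perm (Fin (n + 1))) : Equiv.Perm (Fin (n + 2)) :=
  (finSuccEquiv' (Fin.last (n + 1))).trans ((Equiv.optionCongr τ).trans (finSuccEquiv' k).symm)

theorem ins_last {n : ℕ} (k : Fin (n + 2)) (τ : Equiv.Perm (Fin (n + 1))) :
    ins k τ (Fin.last (n + 1)) = k := by
  simp [ins]

theorem ins_castSucc {n : ℕ} (k : Fin (n + 2)) (τ : Equiv.Perm (Fin (n + 1))) (i : Fin (n + 1)) :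
    ins k τ i.castSucc = k.succAbove (τ i) := by
  have : finSuccEquiv' (Fin.last (n + 1)) i.castSucc = some i := by
    rw [← Fin.succAbove_last, finSuccEquiv'_succAbove]
  simp [ins, this]

theorem ins_bij (n : ℕ) : Function.Bijective
    (fun p : Fin (n + 2) × Equiv.Perm (Fin (n + 1)) => ins p.1 p.2) := by
  rw [Fintype.bijective_iff_injective_and_card]
  constructor
  · rintro ⟨k, τ⟩ ⟨k', τ'⟩ h
    simp only at h
    have hk : k = k' := by rw [← ins_last k τ, h, ins_last]
    subst hk
    have : τ = τ' := by
      ext i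
      have h1 := ins_castSucc k τ i
      rw [h, ins_castSucc] at h1
      rw [Fin.succAbove_right_injective h1]
    rw [this]
  · simp [Fintype.card_perm, Nat.factorial_succ]

/-- The permutation has prescribed peaks. -/
def Good (S : Finset ℕ) {n : ℕ} (τ : Equiv.Perm (Fin (n + 1))) : Prop :=
  ∀ i, 1 ≤ i → i ≤ n → (IsPeak τ i ↔ i ∈ S)

/-- The permutation ends with an ascent. -/
def Up {n : ℕ} (τ : Equiv.Perm (Fin (n + 1))) : Prop :=
  ∃ _ : 1 ≤ n, τ ⟨n - 1, by omega⟩ < τ (Fin.last n)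

theorem peak_ins_of_le {n : ℕ} (k : Fin (n + 2)) (τ : Equiv.Perm (Fin (n + 1))) (i : ℕ)
    (hi : i ≤ n) : IsPeak (ins k τ) i ↔ IsPeak τ i := by
  have key : ∀ (j : ℕ) (h : j < n + 1) (h' : j < n + 2),
      ins k τ ⟨j, h'⟩ = k.succAbove (τ ⟨j, h⟩) := fun j h _ => ins_castSucc k τ ⟨j, h⟩
  constructor
  · rintro ⟨h2, h3, h4, h5⟩
    refine ⟨h2, by omega, ?_, ?_⟩
    · rwa [key _ (by omega), key _ (by omega), Fin.succAbove_lt_succAbove_iff] at h4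
    · rwa [key _ (by omega), key _ (by omega), Fin.succAbove_lt_succAbove_iff] at h5
  · rintro ⟨h2, h3, h4, h5⟩
    refine ⟨h2, by omega, ?_, ?_⟩
    · rwa [key _ (by omega), key _ (by omega), Fin.succAbove_lt_succAbove_iff]
    · rwa [key _ (by omega), key _ (by omega), Fin.succAbove_lt_succAbove_iff]

theorem peak_ins_last {n : ℕ} (k : Fin (n + 2)) (τ : Equiv.Perm (Fin (n + 1))) :
    IsPeak (ins k τ) (n + 1) ↔ Up τ ∧ k.val ≤ (τ (Fin.last n)).val := by
  have key : ∀ (j : ℕ) (h : j < n + 1) (h' : j < n + 2),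
      ins k τ ⟨j, h'⟩ = k.succAbove (τ ⟨j, h⟩) := fun j h _ => ins_castSucc k τ ⟨j, h⟩
  have e : ∀ h, ins k τ ⟨n + 1, h⟩ = k := fun _ => ins_last k τ
  have e2 : ∀ h, ins k τ ⟨n, h⟩ = k.succAbove (τ (Fin.last n)) :=
    fun _ => ins_castSucc k τ (Fin.last n)
  constructor
  · rintro ⟨h2, h3, h4, h5⟩
    simp only [Nat.add_sub_cancel] at h4 h5
    rw [e2, key _ (by omega), Fin.succAbove_lt_succAbove_iff] at h4
    rw [e2, e, Fin.lt_succAbove_iff_le_castSucc] at h5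
    exact ⟨⟨by omega, h4⟩, h5⟩
  · rintro ⟨⟨h1, h4⟩, h5⟩
    refine ⟨by omega, by omega, ?_, ?_⟩
    · simp only [Nat.add_sub_cancel]
      rw [e2, key _ (by omega), Fin.succAbove_lt_succAbove_iff]
      exact h4
    · simp only [Nat.add_sub_cancel]
      rw [e2, e, Fin.lt_succAbove_iff_le_castSucc]
      exact h5

theorem up_ins {n : ℕ} (k : Fin (n + 2)) (τ : Equiv.Perm (Fin (n + 1))) :
    Up (ins k τ) ↔ (τ (Fin.last n)).val < k.val := by
  have e2 : ∀ h, ins k τ ⟨n, h⟩ = k.succAbove (τ (Fin.last n)) :=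
    fun _ => ins_castSucc k τ (Fin.last n)
  constructor
  · rintro ⟨h1, h2⟩
    simp only [Nat.add_sub_cancel] at h2
    rw [e2, ins_last, Fin.succAbove_lt_iff_castSucc_lt] at h2
    exact h2
  · intro h
    refine ⟨by omega, ?_⟩
    simp only [Nat.add_sub_cancel]
    rw [e2, ins_last, Fin.succAbove_lt_iff_castSucc_lt]
    exact h

theorem good_ins (S : Finset ℕ) {n : ℕ} (k : Fin (n + 2)) (τ : Equiv.Perm (Fin (n + 1))) :
    Good S (ins k τ) ↔
      Good S τ ∧ ((Up τ ∧ k.val ≤ (τ (Fin.last n)).val) ↔ n + 1 ∈ S) := by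
  rw [← peak_ins_last]
  constructor
  · intro h
    refine ⟨fun i h1 h2 => ?_, h (n + 1) (by omega) (by omega)⟩
    rw [← peak_ins_of_le k τ i h2]
    exact h i h1 (by omega)
  · rintro ⟨h, h'⟩ i h1 h2
    rcases Nat.lt_or_ge n i with h3 | h3
    · obtain rfl : i = n + 1 := by omega
      exact h'
    · rw [peak_ins_of_le k τ i h3]
      exact h i h1 h3

/-- Transfer recursion for the pair (last step up, last step down). -/
noncomputable def G (S : Finset ℕ) : ℕ → C(ℝ, ℝ) × C(ℝ, ℝ)
  | 0 => (0, 1)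
  | i + 1 => if i + 1 ∈ S then (0, D (G S i).1) else (U ((G S i).1 + (G S i).2), D (G S i).2)

open Classical in
theorem G_eq (S : Finset ℕ) (n : ℕ) :
    (G S n).1 = (∑ τ : Equiv.Perm (Fin (n + 1)),
      if Good S τ ∧ Up τ then BB n (τ (Fin.last n)).val else 0) ∧
    (G S n).2 = (∑ τ : Equiv.Perm (Fin (n + 1)),
      if Good S τ ∧ ¬ Up τ then BB n (τ (Fin.last n)).val else 0) := by
  induction n with
  | zero =>
    have hU : ∀ τ : Equiv.Perm (Fin 1), ¬ Up τ := fun τ h => absurd h.1 (by norm_num)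
    have hG : ∀ τ : Equiv.Perm (Fin 1), Good S τ := fun τ i h1 h2 => by omega
    constructor
    · simp [hU, G]
    · simp [hU, hG, G]
      ext x; simp [BB, bb_apply]
  | succ n ih =>
    obtain ⟨ih1, ih2⟩ := ih
    have hb := ins_bij n
    have hr : ∀ F : Equiv.Perm (Fin (n + 2)) → C(ℝ, ℝ), ∑ σ, F σ =
        ∑ τ : Equiv.Perm (Fin (n + 1)), ∑ k : Fin (n + 2), F (ins k τ) := by
      intro F
      rw [← hb.sum_comp F, Fintype.sum_prod_type, Finset.sum_comm]
    have hUB : ∀ τ : Equiv.Perm (Fin (n + 1)), U (BB n (τ (Fin.last n)).val) =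
        ∑ k : Fin (n + 2), if (τ (Fin.last n)).val < k.val then BB (n + 1) k.val else 0 := by
      intro τ
      rw [U_BB _ _ (by omega), Finset.sum_range]
    have hDB : ∀ τ : Equiv.Perm (Fin (n + 1)), D (BB n (τ (Fin.last n)).val) =
        ∑ k : Fin (n + 2), if k.val ≤ (τ (Fin.last n)).val then BB (n + 1) k.val else 0 := by
      intro τ
      rw [D_BB _ _ (by omega), Finset.sum_range]
    rw [hr, hr]
    simp only [good_ins, up_ins, ins_last]
    by_cases hS : n + 1 ∈ S
    · simp only [G, hS, if_true, iff_true]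
      constructor
      · symm
        refine Finset.sum_eq_zero (fun τ _ => Finset.sum_eq_zero (fun k _ => if_neg ?_))
        rintro ⟨⟨_, _, h1⟩, h2⟩
        omega
      · rw [ih1, D_sum]
        refine Finset.sum_congr rfl (fun τ _ => ?_)
        by_cases h : Good S τ ∧ Up τ
        · rw [if_pos h, hDB]
          refine Finset.sum_congr rfl (fun k _ => ?_)
          simp [h.1, h.2]
        · rw [if_neg h, D_zero]
          symm
          refine Finset.sum_eq_zero (fun k _ => if_neg ?_)
          tauto
    · simp only [G, hS, if_false, iff_false]
      constructor
      · rw [ih1, ih2, ← Finset.sum_add_distrib, U_sum]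
        refine Finset.sum_congr rfl (fun τ _ => ?_)
        by_cases h : Good S τ
        · have : ((if Good S τ ∧ Up τ then BB n (τ (Fin.last n)).val else 0) +
              if Good S τ ∧ ¬ Up τ then BB n (τ (Fin.last n)).val else 0) =
              BB n (τ (Fin.last n)).val := by
            by_cases h' : Up τ <;> simp [h, h']
          rw [this, hUB]
          refine Finset.sum_congr rfl (fun k _ => ?_)
          by_cases h1 : (τ (Fin.last n)).val < k.val
          · rw [if_pos h1, if_pos ⟨⟨h, fun h' => by omega⟩, h1⟩]
          · rw [if_neg h1, if_neg (fun h' => h1 h'.2)]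
        · simp [h, U_zero]
      · rw [ih2, D_sum]
        refine Finset.sum_congr rfl (fun τ _ => ?_)
        by_cases h : Good S τ ∧ ¬ Up τ
        · rw [if_pos h, hDB]
          refine Finset.sum_congr rfl (fun k _ => ?_)
          simp [h.1, h.2]
        · rw [if_neg h, D_zero]
          symm
          refine Finset.sum_eq_zero (fun k _ => if_neg ?_)
          rintro ⟨⟨h1, h2⟩, h3⟩
          exact h ⟨h1, fun h4 => h2 ⟨h4, by omega⟩⟩

theorem peakSet_eq_iff (S : Finset ℕ) (n : ℕ) (hS : ∀ i ∈ S, 1 ≤ i ∧ i ≤ n)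
    (τ : Equiv.Perm (Fin (n + 1))) : peakSet τ = S ↔ Good S τ := by
  constructor
  · rintro rfl i h1 h2
    simp [peakSet]
    omega
  · intro h
    ext i
    simp only [peakSet, Finset.mem_filter, Finset.mem_range]
    constructor
    · rintro ⟨h1, h2⟩
      have := h2.1
      exact (h i (by omega) (by omega)).1 h2
    · intro hi
      have := hS i hi
      exact ⟨by omega, (h i this.1 this.2).2 hi⟩

theorem numPeakSet_eq (S : Finset ℕ) (n : ℕ) (hS : ∀ i ∈ S, 1 ≤ i ∧ i ≤ n) :
    (numPeakSet (n + 1) S : ℝ) =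
      (n + 1).factorial * ∫ t in (0:ℝ)..1, ((G S n).1 + (G S n).2) t := by
  classical
  have h1 : (G S n).1 + (G S n).2 =
      ∑ τ : Equiv.Perm (Fin (n + 1)), if Good S τ then BB n (τ (Fin.last n)).val else 0 := by
    rw [(G_eq S n).1, (G_eq S n).2, ← Finset.sum_add_distrib]
    refine Finset.sum_congr rfl (fun τ _ => ?_)
    by_cases h : Good S τ <;> by_cases h' : Up τ <;> simp [h, h']
  have h2 : ∀ f : C(ℝ, ℝ), ∫ t in (0:ℝ)..1, f t = U f 1 := fun _ => rfl
  rw [h2, h1, U_sum, ContinuousMap.sum_apply]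
  have h3 : ∀ τ : Equiv.Perm (Fin (n + 1)),
      U (if Good S τ then BB n (τ (Fin.last n)).val else 0) 1 =
        if Good S τ then 1 / ((n + 1).factorial : ℝ) else 0 := by
    intro τ
    split_ifs
    · rw [← h2, BB, int_bb]
      congr 3; omega
    · simp [U_zero]
  simp only [h3]
  rw [← Finset.sum_filter, Finset.sum_const, nsmul_eq_mul, numPeakSet]
  have h4 : Nat.card {σ : Equiv.Perm (Fin (n + 1)) // peakSet σ = S} =
      (Finset.univ.filter (fun τ : Equiv.Perm (Fin (n + 1)) => Good S τ)).card := by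
    rw [Nat.card_eq_fintype_card, Fintype.card_subtype]
    congr 1
    ext τ
    simp [peakSet_eq_iff S n hS]
  rw [h4]
  have : ((n + 1).factorial : ℝ) ≠ 0 := by positivity
  field_simp

/-! ### Compositions -/

theorem compPeaks_single (c : ℕ) : compPeaks [c] = ∅ := by simp [compPeaks]

theorem mem_compPeaks_cons (c g : ℕ) (l : List ℕ) (i : ℕ) :
    i ∈ compPeaks (c :: g :: l) ↔ i = c ∨ ∃ j ∈ compPeaks (g :: l), i = c + j := by
  simp only [compPeaks, Finset.mem_image, Finset.mem_range, List.length_cons]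
  constructor
  · rintro ⟨a, ha, rfl⟩
    cases a with
    | zero => left; simp
    | succ a => right; exact ⟨_, ⟨a, by omega, rfl⟩, by simp⟩
  · rintro (rfl | ⟨j, ⟨a, ha, rfl⟩, rfl⟩)
    · exact ⟨0, by omega, by simp⟩
    · exact ⟨a + 1, by omega, by simp⟩

theorem compPeaks_bounds (g : ℕ) (l : List ℕ) (hl : ∀ x ∈ g :: l, 0 < x) (i : ℕ)
    (hi : i ∈ compPeaks (g :: l)) : 0 < i ∧ i < (g :: l).sum := by
  induction l generalizing g i with
  | nil => simp [compPeaks_single] at hi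
  | cons g' l ih =>
    have hg : 0 < g := hl g (by simp)
    have hg' : 0 < g' := hl g' (by simp)
    rw [mem_compPeaks_cons] at hi
    rcases hi with rfl | ⟨j, hj, rfl⟩
    · simp only [List.sum_cons]; omega
    · have := ih g' (fun x hx => hl x (by simp at hx ⊢; tauto)) j hj
      simp only [List.sum_cons] at this ⊢; omega

theorem G_run_block (S : Finset ℕ) (off : ℕ) (f : C(ℝ, ℝ)) (h0 : G S off = (0, f)) (j : ℕ)
    (hS : ∀ i, off < i → i ≤ off + j → i ∉ S) : G S (off + j) = (Z j f, D^[j] f) := by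
  induction j with
  | zero => simpa [Z] using h0
  | succ j ih =>
    have h1 := ih (fun i h1 h2 => hS i h1 (by omega))
    have h2 : off + j + 1 ∉ S := hS _ (by omega) (by omega)
    rw [← add_assoc]
    simp only [G, h2, if_false, h1]
    rw [Z_add, Function.iterate_succ_apply']
    rfl

theorem G_run (S : Finset ℕ) (g : ℕ) (l : List ℕ) (hl : ∀ x ∈ g :: l, 0 < x) (off : ℕ)
    (f : C(ℝ, ℝ)) (h0 : G S off = (0, f))
    (hS : ∀ i, 0 < i → i < (g :: l).sum → (off + i ∈ S ↔ i ∈ compPeaks (g :: l))) :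
    ∫ t in (0:ℝ)..1, ((G S (off + (g :: l).sum - 1)).1 + (G S (off + (g :: l).sum - 1)).2) t =
      run (g :: l) f := by
  induction l generalizing g off f with
  | nil =>
    have hg : 0 < g := hl g (by simp)
    have h1 := G_run_block S off f h0 (g - 1) (fun i h1 h2 => by
      obtain ⟨j, rfl⟩ := Nat.exists_eq_add_of_le h1.le
      rw [hS j (by omega) (by simp; omega), compPeaks_single]; simp)
    have e : off + [g].sum - 1 = off + (g - 1) := by simp; omega
    rw [e, h1]
    simp only [Z_add, run]
  | cons g' l ih =>
    have hg : 0 < g := hl g (by simp)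
    have hl' : ∀ x ∈ g' :: l, 0 < x := fun x hx => hl x (by simp at hx ⊢; tauto)
    have hg' : 0 < g' := hl g' (by simp)
    have hsum : (g :: g' :: l).sum = g + (g' :: l).sum := by simp
    have hsp : 0 < (g' :: l).sum := by simp; omega
    have h1 := G_run_block S off f h0 (g - 1) (fun i h1 h2 => by
      obtain ⟨j, rfl⟩ := Nat.exists_eq_add_of_le h1.le
      rw [hS j (by omega) (by omega), mem_compPeaks_cons]
      rintro (h | ⟨a, _, h⟩) <;> omega)
    have h2 : off + g ∈ S := by
      rw [hS g hg (by omega), mem_compPeaks_cons]; left; rfl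
    have h3 : G S (off + g) = (0, D (Z (g - 1) f)) := by
      obtain ⟨k, rfl⟩ : ∃ k, g = k + 1 := ⟨g - 1, by omega⟩
      rw [← add_assoc] at h2 ⊢
      simp only [Nat.add_sub_cancel] at h1 ⊢
      simp only [G, h2, if_true, h1]
    have h4 := ih g' hl' (off + g) _ h3 (fun i hi1 hi2 => by
      rw [add_assoc, hS (g + i) (by omega) (by omega), mem_compPeaks_cons]
      constructor
      · rintro (h | ⟨a, ha, h⟩)
        · omega
        · obtain rfl : i = a := by omega
          exact ha
      · intro h
        right; exact ⟨i, h, rfl⟩)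
    rw [hsum, ← add_assoc, h4]
    rfl

theorem Pcomp_eq (g : ℕ) (l : List ℕ) (hl : ∀ x ∈ g :: l, 0 < x) :
    (Pcomp (g :: l) : ℝ) = ((g :: l).sum.factorial : ℝ) * run (g :: l) 1 := by
  have hg : 0 < g := hl g (by simp)
  obtain ⟨n, hn⟩ : ∃ n, (g :: l).sum = n + 1 := ⟨(g :: l).sum - 1, by simp; omega⟩
  have h := G_run (compPeaks (g :: l)) g l hl 0 1 rfl (fun i _ _ => by simp)
  rw [← h, Pcomp, hn, numPeakSet_eq]
  · simp
  · intro i hi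
    have := compPeaks_bounds g l hl i hi
    omega

theorem main (m : ℕ) (c : List ℕ) (hc : IsComposition (3 * (m + 2) + 1) c) :
    IsMaximal c ↔ ∃ s t : ℕ, 1 ≤ s ∧ s + t = m + 1 ∧
      c = List.replicate s 3 ++ [2] ++ List.replicate t 3 ++ [2] := by
  obtain ⟨hpos, hsum⟩ := hc
  have key : ∀ b : List ℕ, IsComposition (3 * (m + 2) + 1) b →
      (Pcomp b : ℝ) = ((3 * (m + 2) + 1).factorial : ℝ) * run b 1 := by
    rintro b ⟨hb, hs⟩
    cases b with
    | nil => simp at hs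
    | cons g l => rw [Pcomp_eq g l hb, hs]
  have hf : (0:ℝ) < ((3 * (m + 2) + 1).factorial : ℝ) := by positivity
  constructor
  · intro hmax
    rcases run_dichotomy m c hpos hsum with ⟨a, t, hat, h⟩ | h
    · exact ⟨a + 1, t, by omega, by omega, h⟩
    · exfalso
      have hb : IsComposition (3 * (m + 2) + 1)
          (List.replicate (m + 1) 3 ++ [2] ++ List.replicate 0 3 ++ [2]) := by
        constructor
        · intro x hx
          simp only [List.mem_append, List.mem_replicate, List.mem_singleton] at hx
          omega
        · simp; omega
      have h1 := hmax _ (by rw [hsum]; exact hb)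
      have h2 : (Pcomp (List.replicate (m + 1) 3 ++ [2] ++ List.replicate 0 3 ++ [2]) : ℝ) ≤
        Pcomp c := by exact_mod_cast h1
      rw [key _ hb, key c ⟨hpos, hsum⟩, run_extremal] at h2
      have := le_of_mul_le_mul_left h2 hf
      simp only [add_zero] at this
      linarith
  · rintro ⟨s, t, hs, hst, hc⟩
    obtain ⟨a, rfl⟩ : ∃ a, s = a + 1 := ⟨s - 1, by omega⟩
    intro b hb
    rw [hsum] at hb
    have h1 : run b 1 ≤ run c 1 := by
      rw [hc, run_extremal, show a + t = m by omega]
      rcases run_dichotomy m b hb.1 hb.2 with ⟨a', t', hat, h⟩ | h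
      · rw [h, run_extremal, hat]
      · exact h.le
    have h2 : (Pcomp b : ℝ) ≤ Pcomp c := by
      rw [key b hb, key c ⟨hpos, hsum⟩]
      gcongr
    exact_mod_cast h2

end PeakMax

theorem most_frequent_peak_set_mod_one (ℓ n : ℕ) (hℓ : 2 ≤ ℓ) (hn : n = 3 * ℓ + 1)
    (c : List ℕ) (hc : IsComposition n c) :
    IsMaximal c ↔
      ∃ s t : ℕ, 1 ≤ s ∧ s + t = ℓ - 1 ∧
        c = List.replicate s 3 ++ [2] ++ List.replicate t 3 ++ [2] := by
  obtain ⟨m, rfl⟩ := Nat.exists_eq_add_of_le' hℓ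
  subst hn
  exact PeakMax.main m c hc
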